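/- Let A° be an R-flat R-algebra topologically of finite type, A = A° ⊗_R K, and h₁, …, h_s ∈ A°. Let Σ = {y ∈ Sp A : |hᵢ(y)| < 1 for i < r and |hᵢ(y)| ≥ 1 for r ≤ i < s} and let Σ° be the locally closed subset of Max A° consisting of all maximal ideals m̄ with hᵢ ∈ m̄ for i < r and hᵢ ∉ m̄ for r ≤ i < s. Then ξ⁻¹(Σ°) = Σ and ξ(Σ) = Σ°. Consequently, ξ induces a bijection between the class of finite Boolean combinations of such special subsets of Sp A and the class of constructible subsets of Spec A°/℘A°. -/

import Mathlib

/-!  Prelude: rigid-analytic basics over a complete non-archimedean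
algebraically closed field `K`. -/

open scoped BoundedContinuousFunction

noncomputable section

namespace RigidQE

variable (K : Type) [NormedField K] [CompleteSpace K] [IsAlgClosed K] [IsUltrametricDist K]

/-- The valuation ring `R = {x : K | ‖x‖ ≤ 1}` of `K`. -/
def Ro : Subring K where
  carrier := {x | ‖x‖ ≤ 1}
  zero_mem' := by simp
  one_mem' := by simp
  add_mem' := fun {a b} ha hb => le_trans (IsUltrametricDist.norm_add_le_max a b) (max_le ha hb)
  neg_mem' := fun {a} ha => by simpa using ha
  mul_mem' := fun {a b} ha hb => le_trans (norm_mul_le a b)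
    (by simpa using mul_le_one₀ ha (norm_nonneg b) hb)

/-- The maximal ideal `℘ = {x : K | ‖x‖ < 1}` of the valuation ring. -/
def RoMax : Ideal (Ro K) where
  carrier := {x | ‖(x : K)‖ < 1}
  zero_mem' := by simp
  add_mem' := fun {a b} ha hb =>
    lt_of_le_of_lt (IsUltrametricDist.norm_add_le_max (a : K) (b : K)) (max_lt ha hb)
  smul_mem' := fun c x hx => by
    have h1 : ‖(c : K)‖ ≤ 1 := c.2
    have : ‖(c : K) * (x : K)‖ ≤ 1 * ‖(x : K)‖ := le_trans (norm_mul_le _ _) (by gcongr)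
    simpa using lt_of_le_of_lt (by simpa using this) hx

/-- The closed unit polydisc `R^m ⊆ K^m`. -/
def UnitBall (m : ℕ) : Set (Fin m → K) := {x | ∀ i, ‖x i‖ ≤ 1}

/-- The `i`-th coordinate function on the unit polydisc, as a bounded continuous function. -/
def coordFn (m : ℕ) (i : Fin m) : (UnitBall K m) →ᵇ K :=
  BoundedContinuousFunction.ofNormedAddCommGroup (fun x => x.1 i)
    ((continuous_apply i).comp continuous_subtype_val) 1 (fun x => x.2 i)

/-- The Tate algebra `K⟨S₁,…,Sₘ⟩` of strictly convergent power series, realised concretely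
as the closure, with respect to the supremum norm, of the algebra of polynomial functions
on the unit polydisc. -/
def TateAlg (m : ℕ) : Subalgebra K ((UnitBall K m) →ᵇ K) :=
  (Algebra.adjoin K (Set.range (coordFn K m))).topologicalClosure

end RigidQE

end

noncomputable section
namespace RigidQE

variable (K : Type) [NormedField K] [CompleteSpace K] [IsAlgClosed K] [IsUltrametricDist K]

/-- The projection `R^{m+N} → R^m` on the first `m` coordinates. -/
def ballProj (m N : ℕ) (z : UnitBall K (m + N)) : UnitBall K m :=
  ⟨fun i => z.1 (Fin.castAdd N i), fun i => z.2 _⟩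

lemma ballProj_continuous (m N : ℕ) : Continuous (ballProj K m N) := by
  apply Continuous.subtype_mk
  exact continuous_pi fun i => (continuous_apply _).comp continuous_subtype_val

/-- Pullback of bounded functions along the projection of polydiscs. -/
def ballPull (m N : ℕ) : ((UnitBall K m) →ᵇ K) →ₐ[K] ((UnitBall K (m + N)) →ᵇ K) where
  toFun f := f.compContinuous ⟨ballProj K m N, ballProj_continuous K m N⟩
  map_one' := by ext z; simp
  map_mul' f g := by ext z; simp
  map_zero' := by ext z; simp
  map_add' f g := by ext z; simp
  commutes' c := by ext z; simp

lemma ballPull_lipschitz (m N : ℕ) : LipschitzWith 1 (ballPull K m N) := by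
  apply LipschitzWith.of_dist_le_mul
  intro f g
  simp only [NNReal.coe_one, one_mul]
  refine (BoundedContinuousFunction.dist_le (dist_nonneg (x := f) (y := g))).2 ?_
  intro z
  exact BoundedContinuousFunction.dist_coe_le_dist (f := f) (g := g) (ballProj K m N z)

lemma ballPull_mem_TateAlg (m N : ℕ) {f : (UnitBall K m) →ᵇ K} (hf : f ∈ TateAlg K m) :
    ballPull K m N f ∈ TateAlg K (m + N) := by
  have hsub : (ballPull K m N) '' (Algebra.adjoin K (Set.range (coordFn K m)) : Set _)
      ⊆ (Algebra.adjoin K (Set.range (coordFn K (m + N))) : Set _) := by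
    rintro g ⟨g', hg', rfl⟩
    have : ballPull K m N g' ∈ (Algebra.adjoin K (Set.range (coordFn K m))).map
        (ballPull K m N) := Subalgebra.mem_map.2 ⟨g', hg', rfl⟩
    rw [AlgHom.map_adjoin] at this
    refine Algebra.adjoin_mono ?_ this
    rintro h ⟨h', ⟨i, rfl⟩, rfl⟩
    exact ⟨Fin.castAdd N i, by ext z; rfl⟩
  have := (image_closure_subset_closure_image (s := (Algebra.adjoin K (Set.range (coordFn K m)) :
      Set _)) (ballPull_lipschitz K m N).continuous) (Set.mem_image_of_mem _ hf)
  exact closure_mono hsub this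

/-- An affinoid variety, realised concretely as the zero locus, inside a closed unit
polydisc, of a set of strictly convergent power series. -/
structure Affinoid where
  m : ℕ
  carrier : Set (UnitBall K m)
  isZeroLocus : ∃ S : Set ((UnitBall K m) →ᵇ K),
    (∀ f ∈ S, f ∈ TateAlg K m) ∧ carrier = {x | ∀ f ∈ S, f x = 0}

variable {K}

/-- Restriction of (bounded continuous) functions on the polydisc to a subset, as plain
functions. -/
def resHom {m : ℕ} (Z : Set (UnitBall K m)) : ((UnitBall K m) →ᵇ K) →ₐ[K] (Z → K) where
  toFun f := fun z => f z.1
  map_one' := rfl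
  map_mul' f g := rfl
  map_zero' := rfl
  map_add' f g := rfl
  commutes' c := rfl

/-- The affinoid algebra of `X`, realised concretely as the algebra of functions on `X`
which are restrictions of strictly convergent power series.  (Since `K` is algebraically
closed, this faithfully represents the reduced affinoid algebra.) -/
def Affinoid.O (X : Affinoid K) : Subalgebra K (X.carrier → K) :=
  (TateAlg K X.m).map (resHom X.carrier)

/-- A basic semianalytic subset of an affinoid variety. -/
def IsBasicSemianalytic (X : Affinoid K) (S : Set X.carrier) : Prop :=
  ∃ (mm n : ℕ) (p q : Fin mm → X.O), n ≤ mm ∧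
    S = {x | (∀ i : Fin mm, (i : ℕ) < n → ‖(p i : X.carrier → K) x‖ ≤ ‖(q i : X.carrier → K) x‖)
      ∧ (∀ i : Fin mm, n ≤ (i : ℕ) → ‖(p i : X.carrier → K) x‖ < ‖(q i : X.carrier → K) x‖)}

/-- A semianalytic subset of an affinoid variety: a finite union of basic sets. -/
def IsSemianalytic (X : Affinoid K) (S : Set X.carrier) : Prop :=
  ∃ (k : ℕ) (B : Fin k → Set X.carrier),
    (∀ j, IsBasicSemianalytic X (B j)) ∧ S = ⋃ j, B j

variable (K)

/-- The product `X × R^N` of an affinoid variety with a closed unit polydisc. -/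
def Affinoid.prod (X : Affinoid K) (N : ℕ) : Affinoid K where
  m := X.m + N
  carrier := {z | ballProj K X.m N z ∈ X.carrier}
  isZeroLocus := by
    obtain ⟨S, hS, hXS⟩ := X.isZeroLocus
    refine ⟨(ballPull K X.m N) '' S, ?_, ?_⟩
    · rintro f ⟨f', hf', rfl⟩
      exact ballPull_mem_TateAlg K X.m N (hS f' hf')
    · ext z
      simp only [Set.mem_setOf_eq, hXS, Set.forall_mem_image]
      rfl

variable {K}

/-- The projection map `X × R^N → X` on points. -/
def Affinoid.projFun (X : Affinoid K) (N : ℕ) (z : (X.prod K N).carrier) : X.carrier :=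
  ⟨ballProj K X.m N z.1, z.2⟩

/-- A subanalytic subset of an affinoid variety: the image of a semianalytic subset of
`X × R^N` under the projection `X × R^N → X`. -/
def IsSubanalytic (X : Affinoid K) (S : Set X.carrier) : Prop :=
  ∃ (N : ℕ) (T : Set (X.prod K N).carrier),
    IsSemianalytic (X.prod K N) T ∧ S = (X.projFun N) '' T

end RigidQE
end

set_option synthInstance.maxHeartbeats 1000000
set_option maxHeartbeats 1000000

noncomputable section
namespace RigidQE

open scoped TensorProduct

variable (K : Type) [NormedField K] [CompleteSpace K] [IsAlgClosed K] [IsUltrametricDist K]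

/-- The ring `R⟨S₁,…,Sₘ⟩` of strictly convergent power series over the valuation ring
`R`: the strictly convergent power series of (Gauss = supremum) norm at most one, as an
`R`-subalgebra of the bounded continuous functions on the polydisc. -/
def TateAlgR (m : ℕ) : Subalgebra (Ro K) ((UnitBall K m) →ᵇ K) where
  carrier := {f | f ∈ TateAlg K m ∧ ‖f‖ ≤ 1}
  add_mem' := fun {f g} hf hg => ⟨add_mem hf.1 hg.1, by
    refine (BoundedContinuousFunction.norm_le zero_le_one).2 fun x => ?_
    have := IsUltrametricDist.norm_add_le_max (f x) (g x)
    refine le_trans (by simpa using this) (max_le ?_ ?_)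
    · exact le_trans (f.norm_coe_le_norm x) hf.2
    · exact le_trans (g.norm_coe_le_norm x) hg.2⟩
  mul_mem' := fun {f g} hf hg => ⟨mul_mem hf.1 hg.1,
    le_trans (norm_mul_le f g) (by simpa using mul_le_one₀ hf.2 (norm_nonneg g) hg.2)⟩
  algebraMap_mem' := fun r => by
    constructor
    · show algebraMap K _ (r : K) ∈ TateAlg K m
      exact Subalgebra.algebraMap_mem _ _
    · show ‖algebraMap K ((UnitBall K m) →ᵇ K) (r : K)‖ ≤ 1
      refine (BoundedContinuousFunction.norm_le zero_le_one).2 fun x => ?_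
      calc ‖(algebraMap K ((UnitBall K m) →ᵇ K) (r : K)) x‖ = ‖(r : K)‖ := by simp
      _ ≤ 1 := r.2

/-- An `R`-algebra is topologically of finite type if it is a homomorphic image of some
ring `R⟨S₁,…,Sₘ⟩` of strictly convergent power series over `R`. -/
def IsTopFinType (A : Type) [CommRing A] [Algebra (Ro K) A] : Prop :=
  ∃ (m : ℕ) (φ : TateAlgR K m →ₐ[Ro K] A), Function.Surjective φ

end RigidQE
end

set_option synthInstance.maxHeartbeats 1000000
set_option maxHeartbeats 1000000

noncomputable section
namespace RigidQE

open scoped TensorProduct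

variable (K : Type) [NormedField K] [CompleteSpace K] [IsAlgClosed K] [IsUltrametricDist K]
variable (A0 : Type) [CommRing A0] [Algebra (Ro K) A0]

/-- The points of `Sp A`, for `A = A° ⊗_R K` the affinoid algebra generated by an
`R`-algebra `A°` topologically of finite type: since `K` is algebraically closed, these
are the `K`-algebra morphisms `A → K`. -/
abbrev SpPts : Type := (K ⊗[Ro K] A0) →ₐ[K] K

/-- The ideal `℘A°` of `A°`. -/
def wpIdeal : Ideal A0 := Ideal.map (algebraMap (Ro K) A0) (RoMax K)

/-- The reduction `ξ(y) = (m_y ∩ A°) + ℘A°` of a point `y ∈ Sp A`. -/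
def redIdeal (y : SpPts K A0) : Ideal A0 :=
  (RingHom.ker y.toRingHom).comap
      (Algebra.TensorProduct.includeRight (R := Ro K) (A := K) (B := A0)).toRingHom
    ⊔ wpIdeal K A0

/-- The special subset of `Sp A` determined by `h₁, …, h_s ∈ A°` and `r ≤ s`:
`{y : ‖hᵢ(y)‖ < 1 for i < r, ‖hᵢ(y)‖ ≥ 1 for r ≤ i < s}`. -/
def specialSet (s r : ℕ) (h : Fin s → A0) : Set (SpPts K A0) :=
  {y | (∀ i : Fin s, (i : ℕ) < r →
          ‖y (Algebra.TensorProduct.includeRight (h i))‖ < 1) ∧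
       (∀ i : Fin s, r ≤ (i : ℕ) →
          1 ≤ ‖y (Algebra.TensorProduct.includeRight (h i))‖)}

/-- The locally closed subset of `Max A°` determined by `h₁, …, h_s ∈ A°` and `r ≤ s`:
the maximal ideals containing `hᵢ` for `i < r` and omitting `hᵢ` for `r ≤ i < s`. -/
def specialLocus (s r : ℕ) (h : Fin s → A0) : Set (Ideal A0) :=
  {I | I.IsMaximal ∧ (∀ i : Fin s, (i : ℕ) < r → h i ∈ I) ∧
       (∀ i : Fin s, r ≤ (i : ℕ) → h i ∉ I)}

/-- Finite Boolean combinations of a family of generating sets. -/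
inductive BoolComb {α : Type} (G : Set (Set α)) : Set α → Prop
  | base {s : Set α} : s ∈ G → BoolComb G s
  | compl {s : Set α} : BoolComb G s → BoolComb G sᶜ
  | union {s t : Set α} : BoolComb G s → BoolComb G t → BoolComb G (s ∪ t)

/-- The maximal spectrum of `A°/℘A°`, realised as the maximal ideals of `A°`
containing `℘A°`. -/
abbrev MaxModWp : Type := {I : Ideal A0 // I.IsMaximal ∧ wpIdeal K A0 ≤ I}

/-- The class of finite Boolean combinations of special subsets of `Sp A`. -/
def specialClass : Set (Set (SpPts K A0)) :=
  {S | BoolComb {T | ∃ (s r : ℕ) (h : Fin s → A0), r ≤ s ∧ T = specialSet K A0 s r h} S}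

/-- The class of constructible subsets of `Spec A°/℘A°` (for the Jacobson, Noetherian
ring `A°/℘A°`: the finite Boolean combinations of closed loci of maximal ideals). -/
def constructibleClass : Set (Set (MaxModWp K A0)) :=
  {C | BoolComb {D | ∃ a : A0, D = {I : MaxModWp K A0 | a ∈ I.1}} C}

/-- The map on subsets induced by the reduction map `ξ`. -/
def redImage (S : Set (SpPts K A0)) : Set (MaxModWp K A0) :=
  {I | ∃ y ∈ S, redIdeal K A0 y = I.1}

end RigidQE
end

set_option linter.unusedSectionVars false

noncomputable section
namespace RigidQE

section ValuationRing

variable {K : Type} [NormedField K] [CompleteSpace K] [IsAlgClosed K] [IsUltrametricDist K]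

lemma Ro.norm_le_one (a : Ro K) : ‖(a : K)‖ ≤ 1 := a.2

lemma mem_RoMax_iff {a : Ro K} : a ∈ RoMax K ↔ ‖(a : K)‖ < 1 := Iff.rfl

lemma Ro.dvd_of_norm_le {a b : Ro K} (hab : ‖(b : K)‖ ≤ ‖(a : K)‖) : a ∣ b := by
  by_cases ha : a = 0
  · subst ha
    have : (b : K) = 0 := by simpa using hab
    have : b = 0 := by ext; simpa using this
    simp [this]
  have ha' : (a : K) ≠ 0 := by simpa using ha
  refine ⟨⟨(b : K) / a, ?_⟩, ?_⟩
  · change ‖(b : K) / a‖ ≤ 1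
    rw [norm_div]
    exact div_le_one_of_le₀ hab (norm_nonneg _)
  · ext
    simp [mul_div_cancel₀ _ ha']

lemma Ro.isUnit_of_norm_eq_one {a : Ro K} (ha : ‖(a : K)‖ = 1) : IsUnit a :=
  isUnit_of_dvd_one (Ro.dvd_of_norm_le (by simp [ha]))

lemma Ro.norm_eq_one_of_notMem {a : Ro K} (ha : a ∉ RoMax K) : ‖(a : K)‖ = 1 :=
  le_antisymm a.2 (not_lt.1 ha)

instance RoMax_isMaximal : (RoMax K).IsMaximal := by
  refine Ideal.isMaximal_iff.2 ⟨by simp [mem_RoMax_iff], fun J x _ hx hxJ => ?_⟩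
  exact (Ideal.eq_top_iff_one J).1
    (Ideal.eq_top_of_isUnit_mem J hxJ (Ro.isUnit_of_norm_eq_one (Ro.norm_eq_one_of_notMem hx)))

lemma norm_le_one_of_root {q : Polynomial (Ro K)} (hq : q.Monic) {x : K}
    (hx : Polynomial.aeval x q = 0) : ‖x‖ ≤ 1 := by
  by_contra! hlt
  have hx0 : x ≠ 0 := fun h => by simp [h] at hlt; linarith
  have hinv : ‖x⁻¹‖ ≤ 1 := by rw [norm_inv]; exact inv_le_one_of_one_le₀ hlt.le
  rw [Polynomial.aeval_eq_sum_range, Finset.sum_range_succ, hq.coeff_natDegree, one_smul] at hx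
  have hlead : x ^ q.natDegree = -∑ i ∈ Finset.range q.natDegree, q.coeff i • x ^ i :=
    eq_neg_of_add_eq_zero_right hx
  have key : ‖∑ i ∈ Finset.range q.natDegree, q.coeff i • x ^ i‖ < ‖x‖ ^ q.natDegree := by
    have hpos : 0 < ‖x‖ ^ q.natDegree := by positivity
    obtain h0 | ⟨i, hi, hle⟩ : q.natDegree = 0 ∨ ∃ i ∈ Finset.range q.natDegree,
        ‖∑ i ∈ Finset.range q.natDegree, q.coeff i • x ^ i‖ ≤ ‖q.coeff i • x ^ i‖ := by
      by_cases h0 : q.natDegree = 0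
      · exact Or.inl h0
      · obtain ⟨i, hi, hle⟩ := IsUltrametricDist.exists_norm_finsetSum_le
          (Finset.range q.natDegree) (fun i => q.coeff i • x ^ i)
        exact Or.inr ⟨i, hi (Finset.nonempty_range_iff.2 h0), hle⟩
    · simp [h0]
    · refine hle.trans_lt ?_
      rw [Subring.smul_def, smul_eq_mul, norm_mul, norm_pow]
      calc ‖(q.coeff i : K)‖ * ‖x‖ ^ i ≤ 1 * ‖x‖ ^ i := by gcongr; exact (q.coeff i).2
        _ < ‖x‖ ^ q.natDegree := by
          rw [one_mul]; exact pow_lt_pow_right₀ hlt (Finset.mem_range.1 hi)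
  rw [← norm_neg, ← hlead, norm_pow] at key
  exact lt_irrefl _ key

lemma Ro.exists_root {q : Polynomial (Ro K)} (hq : q.Monic) (hdeg : q.natDegree ≠ 0) :
    ∃ a : Ro K, q.IsRoot a := by
  have hdeg' : (q.map (algebraMap (Ro K) K)).degree ≠ 0 := by
    rw [hq.degree_map, Polynomial.degree_eq_natDegree hq.ne_zero]
    exact_mod_cast hdeg
  obtain ⟨x, hx⟩ := IsAlgClosed.exists_root _ hdeg'
  have hx' : Polynomial.aeval x q = 0 := by
    rwa [Polynomial.IsRoot, Polynomial.eval_map_algebraMap] at hx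
  refine ⟨⟨x, norm_le_one_of_root hq hx'⟩, ?_⟩
  have : (algebraMap (Ro K) K) (q.eval ⟨x, norm_le_one_of_root hq hx'⟩) = 0 := by
    rw [← Polynomial.aeval_algebraMap_apply_eq_algebraMap_eval]
    exact hx'
  exact Subtype.ext this

instance : Field (Ro K ⧸ RoMax K) := Ideal.Quotient.field _

instance residueField_isAlgClosed : IsAlgClosed (Ro K ⧸ RoMax K) := by
  refine IsAlgClosed.of_exists_root _ fun p hp hirr => ?_
  obtain ⟨q, hqp, hdeg, hq⟩ := Polynomial.lifts_and_natDegree_eq_and_monic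
    (Polynomial.map_surjective (Ideal.Quotient.mk (RoMax K)) Ideal.Quotient.mk_surjective p) hp
  obtain ⟨a, ha⟩ := Ro.exists_root hq (by rw [hdeg]; exact hirr.natDegree_pos.ne')
  refine ⟨Ideal.Quotient.mk _ a, ?_⟩
  rw [← hqp]
  rw [Polynomial.eval_map, Polynomial.eval₂_at_apply, ha, map_zero]

/-- The valuation ring of an algebraically closed field has no nontrivial integral
extension domains. -/
lemma Ro.surjective_of_isIntegral {B : Type*} [CommRing B] [IsDomain B] [Algebra (Ro K) B]
    {b : B} (hb : IsIntegral (Ro K) b) : ∃ a : Ro K, algebraMap (Ro K) B a = b := by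
  obtain ⟨q, hq, hqb⟩ := hb
  induction hn : q.natDegree generalizing q with
  | zero =>
    rw [Polynomial.eq_one_of_monic_natDegree_zero hq hn] at hqb
    simp at hqb
  | succ n ih =>
    obtain ⟨a, ha⟩ := Ro.exists_root hq (by omega)
    obtain ⟨q', rfl⟩ := Polynomial.dvd_iff_isRoot.2 ha
    have hq' : q'.Monic := (Polynomial.monic_X_sub_C a).of_mul_monic_left hq
    rw [Polynomial.eval₂_mul, mul_eq_zero] at hqb
    obtain h | h := hqb
    · refine ⟨a, ?_⟩
      simp only [Polynomial.eval₂_sub, Polynomial.eval₂_X, Polynomial.eval₂_C] at h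
      exact (sub_eq_zero.1 h).symm
    · refine ih q' hq' h ?_
      rw [Polynomial.Monic.natDegree_mul (Polynomial.monic_X_sub_C a) hq'] at hn
      simp at hn
      omega

end ValuationRing

end RigidQE
end

noncomputable section
namespace RigidQE

section TateAlgebra

variable {K : Type} [NormedField K] [CompleteSpace K] [IsAlgClosed K] [IsUltrametricDist K]
variable {m m' : ℕ}

/-- Evaluation of an integral strictly convergent power series at a point. -/
def evalR (x : UnitBall K m) : TateAlgR K m →ₐ[Ro K] Ro K where
  toFun f := ⟨f.1 x, (f.1.norm_coe_le_norm x).trans f.2.2⟩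
  map_one' := rfl
  map_mul' _ _ := rfl
  map_zero' := rfl
  map_add' _ _ := rfl
  commutes' _ := rfl

lemma coe_evalR (x : UnitBall K m) (f : TateAlgR K m) : (evalR x f : K) = f.1 x := rfl

lemma evalR_ext {f g : TateAlgR K m} (h : ∀ x, evalR x f = evalR x g) : f = g := by
  ext x
  exact congrArg Subtype.val (h x)

lemma smul_val_apply (c : Ro K) (f : TateAlgR K m) (x : UnitBall K m) :
    (c • f).1 x = (c : K) * f.1 x := rfl

lemma TateAlgR.dvd_of_norm_le {c : Ro K} (hc : c ≠ 0) {f : TateAlgR K m}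
    (h : ∀ x, ‖f.1 x‖ ≤ ‖(c : K)‖) : ∃ g : TateAlgR K m, f = c • g := by
  have hc' : (c : K) ≠ 0 := by simpa using hc
  refine ⟨⟨(c : K)⁻¹ • f.1, Subalgebra.smul_mem _ f.2.1 _, ?_⟩, ?_⟩
  · refine (BoundedContinuousFunction.norm_le zero_le_one).2 fun x => ?_
    rw [BoundedContinuousFunction.smul_apply, smul_eq_mul, norm_mul, norm_inv, inv_mul_eq_div]
    exact div_le_one_of_le₀ (h x) (norm_nonneg _)
  · ext x
    rw [smul_val_apply]
    simp [mul_inv_cancel_left₀ hc']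

/-- The coordinates of a point of the unit polydisc, as elements of the valuation ring. -/
def toRo (x : UnitBall K m) : Fin m → Ro K := fun i => ⟨x.1 i, x.2 i⟩

/-- The point of the unit polydisc with given coordinates in the valuation ring. -/
def ofRo (x : Fin m → Ro K) : UnitBall K m := ⟨fun i => x i, fun i => (x i).2⟩

@[simp] lemma toRo_ofRo (x : Fin m → Ro K) : toRo (ofRo x) = x := rfl

/-- The coordinate functions as integral strictly convergent power series. -/
def coordR (i : Fin m) : TateAlgR K m :=
  ⟨coordFn K m i, Subalgebra.le_topologicalClosure _ (Algebra.subset_adjoin ⟨i, rfl⟩),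
    (BoundedContinuousFunction.norm_le zero_le_one).2 fun x => x.2 i⟩

@[simp] lemma evalR_coordR (x : UnitBall K m) (i : Fin m) : evalR x (coordR i) = toRo x i := rfl

/-- Polynomials over the valuation ring as integral strictly convergent power series. -/
def polyR (K : Type) [NormedField K] [CompleteSpace K] [IsAlgClosed K] [IsUltrametricDist K]
    (m : ℕ) : MvPolynomial (Fin m) (Ro K) →ₐ[Ro K] TateAlgR K m :=
  MvPolynomial.aeval coordR

@[simp] lemma evalR_polyR (x : UnitBall K m) (p : MvPolynomial (Fin m) (Ro K)) :
    evalR x (polyR K m p) = MvPolynomial.eval (toRo x) p := by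
  rw [polyR, ← AlgHom.comp_apply, MvPolynomial.comp_aeval]
  simp only [evalR_coordR]
  rfl

/-- An infinite residue field detects the coefficients of a polynomial by its values. -/
lemma exists_norm_eval_eq_one {p : MvPolynomial (Fin m) (Ro K)}
    (hp : MvPolynomial.map (Ideal.Quotient.mk (RoMax K)) p ≠ 0) :
    ∃ x : UnitBall K m, ‖(evalR x (polyR K m p) : K)‖ = 1 := by
  have : Infinite (Ro K ⧸ RoMax K) := IsAlgClosed.instInfinite
  by_contra! hcon
  refine hp (MvPolynomial.funext fun z => ?_)
  choose w hw using fun i => Ideal.Quotient.mk_surjective (I := RoMax K) (z i)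
  have hlt := lt_of_le_of_ne (evalR (ofRo w) (polyR K m p)).2 (hcon (ofRo w))
  rw [evalR_polyR, toRo_ofRo] at hlt
  have hz : z = fun i => Ideal.Quotient.mk (RoMax K) (w i) := (funext hw).symm
  rw [hz, MvPolynomial.eval_map, map_zero]
  change MvPolynomial.eval₂ _ (⇑(Ideal.Quotient.mk (RoMax K)) ∘ w) p = _
  rw [← MvPolynomial.eval₂_comp]
  exact Ideal.Quotient.eq_zero_iff_mem.2 hlt

/-- Polynomial functions on the unit polydisc. -/
lemma exists_mvPolynomial_of_mem_adjoin {f : (UnitBall K m) →ᵇ K}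
    (hf : f ∈ Algebra.adjoin K (Set.range (coordFn K m))) :
    ∃ p : MvPolynomial (Fin m) K, ∀ x, f x = MvPolynomial.eval x.1 p := by
  rw [Algebra.adjoin_range_eq_range_aeval] at hf
  obtain ⟨p, rfl⟩ := hf
  refine ⟨p, fun x => ?_⟩
  change MvPolynomial.aeval (coordFn K m) p x = _
  induction p using MvPolynomial.induction_on with
  | C a => simp
  | add p q hp hq => simp [hp, hq]
  | mul_X p i hp => simp only [map_mul, BoundedContinuousFunction.mul_apply, hp,
      MvPolynomial.aeval_X, MvPolynomial.eval_X]; rfl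

lemma exists_smul_mvPolynomial {p : MvPolynomial (Fin m) K} (hp : p ≠ 0) :
    ∃ (c : K) (q : MvPolynomial (Fin m) (Ro K)), c ≠ 0 ∧
      p = c • MvPolynomial.map (algebraMap (Ro K) K) q ∧
      MvPolynomial.map (Ideal.Quotient.mk (RoMax K)) q ≠ 0 := by
  obtain ⟨d, hd, hmax⟩ := Finset.exists_max_image p.support (fun d => ‖p.coeff d‖)
    (MvPolynomial.support_nonempty.2 hp)
  have hc : p.coeff d ≠ 0 := MvPolynomial.mem_support_iff.1 hd
  have hle : ∀ e, ‖p.coeff e / p.coeff d‖ ≤ 1 := fun e => by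
    rw [norm_div]
    refine div_le_one_of_le₀ ?_ (norm_nonneg _)
    by_cases he : e ∈ p.support
    · exact hmax e he
    · simp [MvPolynomial.notMem_support_iff.1 he]
  obtain ⟨q, hq⟩ : (p.coeff d)⁻¹ • p ∈ (MvPolynomial.map (algebraMap (Ro K) K) :
      MvPolynomial (Fin m) (Ro K) →+* _).range := by
    change _ ∈ Set.range _
    rw [MvPolynomial.mem_range_map_iff_coeffs_subset]
    intro a ha
    obtain ⟨e, -, rfl⟩ := MvPolynomial.mem_coeffs_iff.1 ha
    exact ⟨⟨_, hle e⟩, by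
      simp only [MvPolynomial.coeff_smul, smul_eq_mul, inv_mul_eq_div]; rfl⟩
  refine ⟨p.coeff d, q, hc, by rw [hq, smul_inv_smul₀ hc], fun h0 => ?_⟩
  have h1 := congrArg (MvPolynomial.coeff d) hq
  rw [MvPolynomial.coeff_map, MvPolynomial.coeff_smul, smul_eq_mul, inv_mul_cancel₀ hc] at h1
  have h2 := congrArg (MvPolynomial.coeff d) h0
  rw [MvPolynomial.coeff_map, MvPolynomial.coeff_zero, Ideal.Quotient.eq_zero_iff_mem,
    mem_RoMax_iff] at h2
  change ((q.coeff d : Ro K) : K) = 1 at h1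
  rw [h1] at h2
  simp at h2

lemma eval_map_eq_evalR_polyR (q : MvPolynomial (Fin m) (Ro K)) (x : UnitBall K m) :
    MvPolynomial.eval x.1 (MvPolynomial.map (algebraMap (Ro K) K) q) =
      (evalR x (polyR K m q) : K) := by
  rw [evalR_polyR, MvPolynomial.eval_map]
  change MvPolynomial.eval₂ _ (⇑(algebraMap (Ro K) K) ∘ toRo x) q = _
  rw [← MvPolynomial.eval₂_comp]
  rfl

/-- A nonzero series is a constant times a series whose reduction is a nonzero polynomial. -/
lemma exists_approx (f : (UnitBall K m) →ᵇ K) (hf : f ∈ TateAlg K m) {ε : ℝ} (hε : 0 < ε)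
    (hεf : ε < ‖f‖) :
    ∃ (c : K) (q : MvPolynomial (Fin m) (Ro K)), c ≠ 0 ∧
      (∀ x, ‖f x - c * (evalR x (polyR K m q) : K)‖ < ε) ∧ ‖f‖ = ‖c‖ ∧
      MvPolynomial.map (Ideal.Quotient.mk (RoMax K)) q ≠ 0 := by
  obtain ⟨g, hg, hfg⟩ := Metric.mem_closure_iff.1 hf ε hε
  obtain ⟨p, hp⟩ := exists_mvPolynomial_of_mem_adjoin hg
  have hlt : ∀ x, ‖f x - g x‖ < ε := fun x =>
    ((f - g).norm_coe_le_norm x).trans_lt (by rwa [← dist_eq_norm])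
  have hp0 : p ≠ 0 := by
    rintro rfl
    have hg0 : g = 0 := by ext x; simp [hp]
    rw [hg0, dist_zero_right] at hfg
    exact lt_asymm hfg hεf
  obtain ⟨c, q, hc, rfl, hq⟩ := exists_smul_mvPolynomial hp0
  have hgx : ∀ x, g x = c * (evalR x (polyR K m q) : K) := fun x => by
    rw [hp, MvPolynomial.smul_eval, eval_map_eq_evalR_polyR]
  refine ⟨c, q, hc, fun x => by rw [← hgx]; exact hlt x, ?_, hq⟩
  have hgle : ∀ x, ‖g x‖ ≤ ‖c‖ := fun x => by
    rw [hgx, norm_mul]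
    exact mul_le_of_le_one_right (norm_nonneg _) (evalR x _).2
  have hng : ‖g‖ = ‖c‖ := by
    refine le_antisymm ((BoundedContinuousFunction.norm_le (norm_nonneg _)).2 hgle) ?_
    obtain ⟨x, hx⟩ := exists_norm_eval_eq_one hq
    have := g.norm_coe_le_norm x
    rwa [hgx, norm_mul, hx, mul_one] at this
  have hball : ‖f - g‖ ≤ ε := by rw [← dist_eq_norm]; exact hfg.le
  refine le_antisymm ?_ ?_
  · obtain h | h := le_or_gt ‖f‖ ‖c‖
    · exact h
    by_contra! hlt'
    have hmax : ‖f‖ ≤ max ‖f - g‖ ‖g‖ := by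
      refine (BoundedContinuousFunction.norm_le (le_max_of_le_left (norm_nonneg _))).2 fun x => ?_
      have h1 := IsUltrametricDist.norm_add_le_max (f x - g x) (g x)
      rw [sub_add_cancel] at h1
      exact h1.trans (max_le_max ((f - g).norm_coe_le_norm x) (g.norm_coe_le_norm x))
    obtain h2 | h2 := le_max_iff.1 hmax
    · rw [← dist_eq_norm] at h2; linarith
    · rw [hng] at h2; exact absurd h2 (not_le.2 h)
  · rw [← hng]
    refine (BoundedContinuousFunction.norm_le (norm_nonneg _)).2 fun x => ?_
    have h1 := IsUltrametricDist.norm_add_le_max (f x) (-(f x - g x))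
    rw [norm_neg, ← sub_eq_add_neg, sub_sub_cancel] at h1
    exact h1.trans (max_le (f.norm_coe_le_norm x) ((hlt x).le.trans hεf.le))

/-- Integral series are polynomials modulo any nonzero constant. -/
lemma exists_eq_polyR_add_smul {c : Ro K} (hc : c ≠ 0) (f : TateAlgR K m) :
    ∃ (p : MvPolynomial (Fin m) (Ro K)) (g : TateAlgR K m), f = polyR K m p + c • g := by
  have hc' : 0 < ‖(c : K)‖ := by simpa using hc
  obtain hle | hlt := le_or_gt ‖f.1‖ ‖(c : K)‖
  · obtain ⟨g, hg⟩ := TateAlgR.dvd_of_norm_le hc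
      (fun x => (f.1.norm_coe_le_norm x).trans hle)
    exact ⟨0, g, by rw [map_zero, zero_add, hg]⟩
  · obtain ⟨a, q, ha, happ, hfa, -⟩ := exists_approx f.1 f.2.1 hc' hlt
    have ha1 : ‖a‖ ≤ 1 := hfa ▸ f.2.2
    obtain ⟨g, hg⟩ := TateAlgR.dvd_of_norm_le (f := f - polyR K m ((⟨a, ha1⟩ : Ro K) • q)) hc
      (fun x => by
        rw [map_smul]
        exact (happ x).le)
    exact ⟨_, g, (sub_eq_iff_eq_add'.1 hg)⟩

lemma exists_norm_lt_one_gt (hK : ∃ a : K, a ≠ 0 ∧ ‖a‖ < 1) {r : ℝ} (hr : r < 1) :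
    ∃ a : Ro K, a ≠ 0 ∧ a ∈ RoMax K ∧ r ≤ ‖(a : K)‖ := by
  by_contra! hcon
  have hr0 : 0 ≤ r := by
    obtain ⟨a, ha, ha1⟩ := hK
    have := hcon ⟨a, ha1.le⟩ (fun h => ha (congrArg Subtype.val h)) ha1
    exact (norm_nonneg _).trans this.le
  obtain ⟨a, ha, ha1⟩ := hK
  obtain ⟨n, hn⟩ := exists_pow_lt_of_lt_one (norm_pos_iff.2 ha) hr
  have hn0 : 0 < n := by
    rcases Nat.eq_zero_or_pos n with rfl | h
    · simp at hn; linarith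
    · exact h
  obtain ⟨b, hb⟩ := IsAlgClosed.exists_pow_nat_eq a hn0
  have hb1 : ‖b‖ < 1 := by
    rw [← pow_lt_one_iff_of_nonneg (norm_nonneg b) hn0.ne', ← norm_pow, hb]
    exact ha1
  have hb0 : b ≠ 0 := by
    rintro rfl
    rw [zero_pow hn0.ne'] at hb
    exact ha hb.symm
  have := hcon ⟨b, hb1.le⟩ (fun h => hb0 (congrArg Subtype.val h)) hb1
  have h2 : ‖b‖ ^ n ≤ r ^ n := pow_le_pow_left₀ (norm_nonneg _) this.le n
  rw [← norm_pow, hb] at h2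
  linarith

/-- Over a nontrivially valued field, a nonzero integral series is a constant times a series
which modulo some topologically nilpotent constant is a polynomial with nonzero reduction. -/
lemma exists_eq_smul_polyR_add_smul (hK : ∃ a : K, a ≠ 0 ∧ ‖a‖ < 1) {f : TateAlgR K m}
    (hf : f ≠ 0) :
    ∃ (c ϖ : Ro K) (p : MvPolynomial (Fin m) (Ro K)) (g : TateAlgR K m),
      c ≠ 0 ∧ ϖ ≠ 0 ∧ ϖ ∈ RoMax K ∧ MvPolynomial.map (Ideal.Quotient.mk (RoMax K)) p ≠ 0 ∧
      f = c • (polyR K m p + ϖ • g) := by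
  have hf1 : f.1 ≠ 0 := fun h => hf (Subtype.ext h)
  have hpos : 0 < ‖f.1‖ := norm_pos_iff.2 hf1
  obtain ⟨ϖ, h0, h1, -⟩ := exists_norm_lt_one_gt hK zero_lt_one
  have hϖ0 : 0 < ‖(ϖ : K)‖ := by simpa using h0
  obtain ⟨a, q, ha, happ, hfa, hq⟩ := exists_approx f.1 f.2.1 (ε := ‖(ϖ : K)‖ * ‖f.1‖)
    (by positivity) (mul_lt_of_lt_one_left hpos h1)
  have ha1 : ‖a‖ ≤ 1 := hfa ▸ f.2.2
  have hc0 : (⟨a, ha1⟩ : Ro K) ≠ 0 := fun h => ha (congrArg Subtype.val h)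
  obtain ⟨g, hg⟩ := TateAlgR.dvd_of_norm_le (f := f - (⟨a, ha1⟩ : Ro K) • polyR K m q)
    (c := (⟨a, ha1⟩ : Ro K) * ϖ) (mul_ne_zero hc0 h0) (fun x => by
      refine (happ x).le.trans_eq ?_
      rw [hfa]
      simp [mul_comm])
  refine ⟨⟨a, ha1⟩, ϖ, q, g, hc0, h0, h1, hq, ?_⟩
  rw [smul_add, smul_smul, ← hg, add_sub_cancel]

end TateAlgebra

end RigidQE
end

noncomputable section
namespace RigidQE

section Completeness

variable {K : Type} [NormedField K] [CompleteSpace K] [IsAlgClosed K] [IsUltrametricDist K]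
variable {m : ℕ}

lemma isClosed_TateAlgR : IsClosed (TateAlgR K m : Set ((UnitBall K m) →ᵇ K)) :=
  (Subalgebra.isClosed_topologicalClosure _).inter (isClosed_le continuous_norm continuous_const)

/-- Geometric series with topologically nilpotent ratio converge in `R⟨S₁,…,Sₘ⟩`. -/
lemma exists_series {ϖ : Ro K} (hϖ : ϖ ∈ RoMax K) (a : ℕ → TateAlgR K m) :
    ∃ s : ℕ → TateAlgR K m, ∀ n, s n = a n + ϖ • s (n + 1) := by
  have hsum : ∀ n, Summable fun i => (ϖ : K) ^ i • (a (n + i)).1 := fun n => by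
    refine Summable.of_norm_bounded (summable_geometric_of_lt_one (norm_nonneg (ϖ : K)) hϖ)
      fun i => ?_
    refine (norm_smul_le _ _).trans ?_
    rw [norm_pow]
    exact mul_le_of_le_one_right (by positivity) (a (n + i)).2.2
  have hmem : ∀ n, ∑' i, (ϖ : K) ^ i • (a (n + i)).1 ∈ TateAlgR K m := fun n => by
    refine isClosed_TateAlgR.mem_of_tendsto (hsum n).hasSum.tendsto_sum_nat
      (Filter.Eventually.of_forall fun N => ?_)
    exact Subalgebra.sum_mem _ fun i _ => Subalgebra.smul_mem _ (a (n + i)).2 (ϖ ^ i)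
  refine ⟨fun n => ⟨_, hmem n⟩, fun n => Subtype.ext ?_⟩
  change ∑' i, (ϖ : K) ^ i • (a (n + i)).1 =
    (a n).1 + (ϖ : K) • ∑' i, (ϖ : K) ^ i • (a (n + 1 + i)).1
  rw [(hsum n).tsum_eq_zero_add, ← (hsum (n + 1)).tsum_const_smul]
  simp only [pow_zero, one_smul, add_zero, smul_smul, pow_succ', add_assoc, add_comm 1]

lemma eq_zero_of_forall_eq_smul {ϖ : Ro K} (hϖ : ϖ ∈ RoMax K) (e : ℕ → TateAlgR K m)
    (he : ∀ n, e n = ϖ • e (n + 1)) : e 0 = 0 := by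
  have h : ∀ n, e 0 = ϖ ^ n • e n := fun n => by
    induction n with
    | zero => simp
    | succ n ih => rw [ih, he n, smul_smul, pow_succ]
  ext x
  have hle : ∀ n, ‖(e 0).1 x‖ ≤ ‖(ϖ : K)‖ ^ n := fun n => by
    rw [h n, smul_val_apply, norm_mul, ← norm_pow]
    exact mul_le_of_le_one_right (norm_nonneg _) (((e n).1.norm_coe_le_norm x).trans (e n).2.2)
  have := ge_of_tendsto' (tendsto_pow_atTop_nhds_zero_of_lt_one (norm_nonneg _) hϖ) hle
  exact norm_le_zero_iff.1 this

lemma isUnit_one_sub_smul {ϖ : Ro K} (hϖ : ϖ ∈ RoMax K) (f : TateAlgR K m) :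
    IsUnit (1 - ϖ • f) := by
  obtain ⟨s, hs⟩ := exists_series hϖ (fun n => f ^ n)
  have h := eq_zero_of_forall_eq_smul hϖ (fun n => s (n + 1) - f * s n) fun n => by
    have h1 := hs (n + 1)
    have h2 := hs n
    rw [Algebra.smul_def] at h1 h2 ⊢
    linear_combination h1 - f * h2
  have h1 : s 1 = f * s 0 := sub_eq_zero.1 h
  refine IsUnit.of_mul_eq_one (s 0) ?_
  rw [sub_mul, one_mul, smul_mul_assoc, ← h1, hs 0]
  simp

end Completeness

end RigidQE
end

noncomputable section
namespace RigidQE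

open Polynomial

section Weierstrass

variable {K : Type} [NormedField K] [CompleteSpace K] [IsAlgClosed K] [IsUltrametricDist K]
variable {m m' : ℕ}

instance : CommRing (TateAlgR K m) := inferInstance

/-- The map of polydiscs whose coordinates are given integral series. -/
def ballMap (g : Fin m' → TateAlgR K m) (x : UnitBall K m) : UnitBall K m' :=
  ofRo fun i => evalR x (g i)

lemma continuous_ballMap (g : Fin m' → TateAlgR K m) : Continuous (ballMap g) :=
  Continuous.subtype_mk (continuous_pi fun i => (g i).1.continuous) _

instance : Nontrivial (TateAlgR K m) := (evalR (ofRo 0 : UnitBall K m)).toRingHom.domain_nontrivial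

lemma toRo_ballMap (g : Fin m' → TateAlgR K m) (x : UnitBall K m) (i : Fin m') :
    toRo (ballMap g x) i = evalR x (g i) := rfl

/-- Composition of bounded functions with `ballMap g`. -/
def compBallMap (g : Fin m' → TateAlgR K m) :
    ((UnitBall K m') →ᵇ K) →ₐ[K] ((UnitBall K m) →ᵇ K) where
  toFun f := f.compContinuous ⟨ballMap g, continuous_ballMap g⟩
  map_one' := rfl
  map_mul' _ _ := rfl
  map_zero' := rfl
  map_add' _ _ := rfl
  commutes' _ := rfl

lemma compBallMap_mem_TateAlg (g : Fin m' → TateAlgR K m) {f : (UnitBall K m') →ᵇ K}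
    (hf : f ∈ TateAlg K m') : compBallMap g f ∈ TateAlg K m := by
  have hlip : LipschitzWith 1 (compBallMap g) := by
    refine LipschitzWith.of_dist_le_mul fun a b => ?_
    rw [NNReal.coe_one, one_mul]
    exact (BoundedContinuousFunction.dist_le dist_nonneg).2 fun z =>
      BoundedContinuousFunction.dist_coe_le_dist (f := a) (g := b) _
  have hsub : compBallMap g '' (Algebra.adjoin K (Set.range (coordFn K m')) : Set _) ⊆
      (TateAlg K m : Set _) := by
    rintro _ ⟨a, ha, rfl⟩
    have h1 : compBallMap g a ∈ (Algebra.adjoin K (Set.range (coordFn K m'))).map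
        (compBallMap g) := Subalgebra.mem_map.2 ⟨a, ha, rfl⟩
    rw [AlgHom.map_adjoin] at h1
    refine (Algebra.adjoin_le_iff.2 ?_ : _ ≤ TateAlg K m) h1
    rintro _ ⟨_, ⟨i, rfl⟩, rfl⟩
    exact (g i).2.1
  have h2 := image_closure_subset_closure_image hlip.continuous (Set.mem_image_of_mem _ hf)
  have hcl : IsClosed (TateAlg K m : Set ((UnitBall K m) →ᵇ K)) :=
    Subalgebra.isClosed_topologicalClosure _
  exact closure_minimal hsub hcl h2

/-- Substitution of integral series into integral series. -/
def substR (g : Fin m' → TateAlgR K m) : TateAlgR K m' →ₐ[Ro K] TateAlgR K m where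
  toFun f := ⟨compBallMap g f.1, compBallMap_mem_TateAlg g f.2.1,
    (BoundedContinuousFunction.norm_le zero_le_one).2 fun _ =>
      (f.1.norm_coe_le_norm _).trans f.2.2⟩
  map_one' := rfl
  map_mul' _ _ := rfl
  map_zero' := rfl
  map_add' _ _ := rfl
  commutes' _ := rfl

lemma evalR_substR (g : Fin m' → TateAlgR K m) (x : UnitBall K m) (f : TateAlgR K m') :
    evalR x (substR g f) = evalR (ballMap g x) f := rfl

/-- The point of the polydisc with given first coordinate and given remaining coordinates. -/
def consBall (t : Ro K) (y : UnitBall K m) : UnitBall K (m + 1) :=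
  ofRo (Fin.cons t (toRo y))

/-- Forgetting the first coordinate. -/
def tailBall (x : UnitBall K (m + 1)) : UnitBall K m := ofRo fun i => toRo x i.succ

/-- Series not involving the first variable. -/
def tailR (K : Type) [NormedField K] [CompleteSpace K] [IsAlgClosed K] [IsUltrametricDist K]
    (m : ℕ) : TateAlgR K m →ₐ[Ro K] TateAlgR K (m + 1) :=
  substR fun i => coordR i.succ

/-- Polynomials in the first variable, with coefficients series in the remaining ones. -/
def iotaR (K : Type) [NormedField K] [CompleteSpace K] [IsAlgClosed K] [IsUltrametricDist K]
    (m : ℕ) : (TateAlgR K m)[X] →+* TateAlgR K (m + 1) :=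
  eval₂RingHom (tailR K m).toRingHom (coordR 0)

@[simp] lemma iotaR_C (f : TateAlgR K m) : iotaR K m (C f) = tailR K m f := eval₂_C _ _

@[simp] lemma iotaR_X : iotaR K m X = coordR 0 := eval₂_X _ _

lemma iotaR_smul (c : Ro K) (p : (TateAlgR K m)[X]) : iotaR K m (c • p) = c • iotaR K m p := by
  have h : c • p = C (algebraMap _ _ c) * p := by
    rw [← smul_eq_C_mul, algebraMap_smul]
  rw [h, map_mul, iotaR_C, AlgHom.commutes, Algebra.smul_def]

lemma evalR_iotaR (x : UnitBall K (m + 1)) (p : (TateAlgR K m)[X]) :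
    evalR x (iotaR K m p) = (p.map (evalR (tailBall x)).toRingHom).eval (toRo x 0) := by
  rw [eval_map]
  exact hom_eval₂ p _ (evalR x).toRingHom _

lemma iotaR_finSuccEquiv (p : MvPolynomial (Fin (m + 1)) (Ro K)) :
    iotaR K m ((MvPolynomial.finSuccEquiv (Ro K) m p).map (polyR K m).toRingHom) =
      polyR K (m + 1) p := by
  refine evalR_ext fun x => ?_
  have hx : toRo x = Fin.cons (toRo x 0) (toRo (tailBall x)) := by
    ext i
    refine Fin.cases ?_ (fun i => ?_) i <;> rfl
  rw [evalR_iotaR, evalR_polyR, hx, MvPolynomial.eval_eq_eval_mv_eval', Polynomial.map_map]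
  have he : (evalR (tailBall x)).toRingHom.comp (polyR K m).toRingHom =
      MvPolynomial.eval (toRo (tailBall x)) := RingHom.ext fun q => evalR_polyR (tailBall x) q
  rw [he]
  rfl

/-- A polynomial over the valuation ring of degree smaller than a monic polynomial cannot be
dominated by it. -/
lemma eq_zero_of_norm_eval_le (hK : ∃ a : K, a ≠ 0 ∧ ‖a‖ < 1) (C₀ : ℝ) {ω r : (Ro K)[X]}
    (hω : ω.Monic) (hr : r.degree < ω.degree)
    (h : ∀ t : Ro K, ‖((r.eval t : Ro K) : K)‖ ≤ C₀ * ‖((ω.eval t : Ro K) : K)‖) : r = 0 := by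
  induction hn : ω.natDegree generalizing ω r with
  | zero =>
    rw [degree_eq_natDegree hω.ne_zero, hn] at hr
    exact degree_eq_bot.1 (Nat.WithBot.lt_zero_iff.1 hr)
  | succ n ih =>
    obtain ⟨α, hα⟩ := Ro.exists_root hω (by omega)
    have hrα : r.IsRoot α := by
      have := h α
      rw [hα.eq_zero] at this
      simpa using this
    obtain ⟨ω', rfl⟩ := dvd_iff_isRoot.2 hα
    obtain ⟨r', rfl⟩ := dvd_iff_isRoot.2 hrα
    have hω' : ω'.Monic := (monic_X_sub_C α).of_mul_monic_left hω
    have hne : ∀ t, t ≠ α → ‖((r'.eval t : Ro K) : K)‖ ≤ C₀ * ‖((ω'.eval t : Ro K) : K)‖ := fun t ht => by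
      have h1 := h t
      simp only [eval_mul, eval_sub, eval_X, eval_C, Subring.coe_mul, norm_mul] at h1
      have hpos : 0 < ‖((t - α : Ro K) : K)‖ :=
        norm_pos_iff.2 fun h0 => ht (sub_eq_zero.1 (Subtype.ext h0))
      rw [mul_left_comm] at h1
      exact le_of_mul_le_mul_left h1 hpos
    have hr' : r' = 0 := by
      refine ih hω' ?_ (fun t => ?_) ?_
      · rw [degree_mul, degree_mul] at hr
        simp only [degree_X_sub_C] at hr
        exact lt_of_add_lt_add_left hr
      · by_cases ht : t = α
        · subst ht
          obtain ⟨ϖ, h0, h1, -⟩ := exists_norm_lt_one_gt hK zero_lt_one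
          have hlim : Filter.Tendsto (fun n : ℕ => t + ϖ ^ n) Filter.atTop (nhds t) := by
            have : Filter.Tendsto (fun n : ℕ => ϖ ^ n) Filter.atTop (nhds 0) := by
              rw [tendsto_subtype_rng]
              simp only [Subring.coe_pow]
              exact tendsto_pow_atTop_nhds_zero_of_norm_lt_one h1
            simpa using this.const_add t
          have hc : ∀ p : (Ro K)[X], Continuous fun s : Ro K => ‖((p.eval s : Ro K) : K)‖ := fun p =>
            (continuous_subtype_val.comp p.continuous).norm
          refine le_of_tendsto_of_tendsto' (((hc r').tendsto t).comp hlim)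
            ((((hc ω').tendsto t).comp hlim).const_mul C₀) fun n => hne _ ?_
          simp [h0]
        · exact hne t ht
      · rw [(monic_X_sub_C α).natDegree_mul hω', natDegree_X_sub_C] at hn
        omega
    rw [hr', mul_zero]

lemma evalR_consBall_iotaR (t : Ro K) (y : UnitBall K m) (p : (TateAlgR K m)[X]) :
    evalR (consBall t y) (iotaR K m p) = (p.map (evalR y).toRingHom).eval t := by
  rw [evalR_iotaR]
  rfl

lemma eq_zero_of_norm_iotaR_le (hK : ∃ a : K, a ≠ 0 ∧ ‖a‖ < 1) (C₀ : ℝ)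
    {ω r : (TateAlgR K m)[X]} (hω : ω.Monic) (hr : r.degree < ω.degree)
    (h : ∀ x, ‖(evalR x (iotaR K m r) : K)‖ ≤ C₀ * ‖(evalR x (iotaR K m ω) : K)‖) : r = 0 := by
  ext1 j
  refine evalR_ext fun y => ?_
  have h0 := eq_zero_of_norm_eval_le hK C₀ (hω.map (evalR y).toRingHom)
    (r := r.map (evalR y).toRingHom)
    (degree_map_le.trans_lt (by rwa [hω.degree_map])) fun t => by
      simpa only [evalR_consBall_iotaR] using h (consBall t y)
  have := congrArg (fun p => p.coeff j) h0
  simpa [coeff_map] using this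

/-- Division modulo a topologically nilpotent constant. -/
lemma exists_division_step {ϖ : Ro K} (hϖ0 : ϖ ≠ 0) {ω : (TateAlgR K m)[X]} (hω : ω.Monic)
    {f f₁ : TateAlgR K (m + 1)} (hf : f = iotaR K m ω + ϖ • f₁) (g : TateAlgR K (m + 1)) :
    ∃ (q : TateAlgR K (m + 1)) (r : (TateAlgR K m)[X]) (g' : TateAlgR K (m + 1)),
      r.degree < ω.degree ∧ g = q * f + iotaR K m r + ϖ • g' := by
  obtain ⟨p, g₁, hg⟩ := exists_eq_polyR_add_smul hϖ0 g
  rw [← iotaR_finSuccEquiv] at hg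
  set P := (MvPolynomial.finSuccEquiv (Ro K) m p).map (polyR K m).toRingHom
  refine ⟨iotaR K m (P /ₘ ω), P %ₘ ω, g₁ - iotaR K m (P /ₘ ω) * f₁,
    degree_modByMonic_lt _ hω, ?_⟩
  have h1 := congrArg (iotaR K m) (modByMonic_add_div P ω)
  rw [map_add, map_mul] at h1
  rw [hg, hf, ← h1]
  simp only [Algebra.smul_def]
  ring

/-- Weierstrass division. -/
lemma exists_division {ϖ : Ro K} (hϖ0 : ϖ ≠ 0) (hϖ : ϖ ∈ RoMax K) {ω : (TateAlgR K m)[X]}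
    (hω : ω.Monic) {f f₁ : TateAlgR K (m + 1)} (hf : f = iotaR K m ω + ϖ • f₁)
    (g : TateAlgR K (m + 1)) :
    ∃ (q : TateAlgR K (m + 1)) (r : (TateAlgR K m)[X]),
      r.degree < ω.degree ∧ g = q * f + iotaR K m r := by
  choose q r g' hr hg using exists_division_step hϖ0 hω hf
  set G : ℕ → TateAlgR K (m + 1) := fun n => g'^[n] g with hG
  have hGs : ∀ n, G (n + 1) = g' (G n) := fun n => Function.iterate_succ_apply' _ _ _
  obtain ⟨Q, hQ⟩ := exists_series hϖ fun n => q (G n)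
  choose S hS using fun j => exists_series hϖ fun n => (r (G n)).coeff j
  set N := ω.natDegree with hN
  have hdeg : ω.degree = N := degree_eq_natDegree hω.ne_zero
  set T : ℕ → (TateAlgR K m)[X] := fun n => ∑ j ∈ Finset.range N, monomial j (S j n) with hT
  have hTc : ∀ n k, (T n).coeff k = if k < N then S k n else 0 := fun n k => by
    simp [hT, coeff_monomial]
  have hrN : ∀ n k, N ≤ k → (r (G n)).coeff k = 0 := fun n k hk => by
    have := hr (G n)
    rw [hdeg] at this
    exact (degree_lt_iff_coeff_zero _ _).1 this k hk
  have hTs : ∀ n, T n = r (G n) + ϖ • T (n + 1) := fun n => by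
    ext1 k
    rw [coeff_add, coeff_smul, hTc, hTc]
    split_ifs with hk
    · exact hS k n
    · rw [hrN n k (not_lt.1 hk), smul_zero, add_zero]
  refine ⟨Q 0, T 0, ?_, ?_⟩
  · rw [hdeg, degree_lt_iff_coeff_zero]
    intro k hk
    rw [hTc, if_neg (not_lt.2 hk)]
  · have := eq_zero_of_forall_eq_smul hϖ (fun n => G n - (Q n * f + iotaR K m (T n)))
      fun n => by
        have h1 := hg (G n)
        have h2 := congrArg (iotaR K m) (hTs n)
        have h3 := hQ n
        rw [map_add, iotaR_smul] at h2
        rw [hGs]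
        simp only [Algebra.smul_def] at *
        linear_combination h1 - h2 - f * h3
    exact sub_eq_zero.1 this

/-- Weierstrass preparation, up to a multiplier. -/
lemma exists_mul_eq_iotaR {ϖ : Ro K} (hϖ0 : ϖ ≠ 0) (hϖ : ϖ ∈ RoMax K) {ω : (TateAlgR K m)[X]}
    (hω : ω.Monic) {f f₁ : TateAlgR K (m + 1)} (hf : f = iotaR K m ω + ϖ • f₁) :
    ∃ (q : TateAlgR K (m + 1)) (ω' : (TateAlgR K m)[X]), ω'.Monic ∧ q * f = iotaR K m ω' := by
  obtain ⟨q, r, hr, h⟩ := exists_division hϖ0 hϖ hω hf (coordR 0 ^ ω.natDegree)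
  refine ⟨q, X ^ ω.natDegree - r, monic_X_pow_sub ?_, ?_⟩
  · have h1 := degree_eq_natDegree hω.ne_zero
    rwa [h1] at hr
  · rw [map_sub, map_pow, iotaR_X, h, add_sub_cancel_right]

end Weierstrass

end RigidQE
end

noncomputable section
namespace RigidQE

section Nagata

open MvPolynomial

/-- The substitution `X₀ ↦ X₀`, `Xᵢ ↦ Xᵢ + X₀ ^ (N ^ i)`. -/
def nagata (A : Type) [CommRing A] (n N : ℕ) :
    MvPolynomial (Fin (n + 1)) A →ₐ[A] MvPolynomial (Fin (n + 1)) A :=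
  aeval fun i => if i = 0 then X 0 else X i + X 0 ^ N ^ (i : ℕ)

variable {k : Type} [Field k] {n N : ℕ}

lemma sum_pow_mul_ne {v w : Fin (n + 1) →₀ ℕ} (hN : 1 < N) (hv : ∀ i, v i < N)
    (hw : ∀ i, w i < N) (hne : v ≠ w) :
    ∑ x : Fin (n + 1), N ^ (x : ℕ) * v x ≠ ∑ x : Fin (n + 1), N ^ (x : ℕ) * w x := by
  intro h
  have hlt : ∀ {u : Fin (n + 1) →₀ ℕ}, (∀ i, u i < N) → ∀ l ∈ List.ofFn u, l < N := by
    intro u hu l hl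
    obtain ⟨i, rfl⟩ := List.mem_ofFn.1 hl
    exact hu i
  refine hne (Finsupp.ext (congrFun (List.ofFn_inj.mp ?_)))
  apply Nat.ofDigits_inj_of_len_eq hN (by simp) (hlt hv) (hlt hw)
  simpa only [Nat.ofDigits_eq_sum_mapIdx, List.mapIdx_eq_ofFn, List.get_ofFn, List.length_ofFn,
    Fin.val_cast, mul_comm, List.sum_ofFn] using! h

lemma degreeOf_zero_nagata (v : Fin (n + 1) →₀ ℕ) {a : k} (ha : a ≠ 0) :
    (nagata k n N (monomial v a)).degreeOf 0 = ∑ i : Fin (n + 1), N ^ (i : ℕ) * v i := by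
  rw [← natDegree_finSuccEquiv, monomial_eq, Finsupp.prod_pow v fun a ↦ X a]
  simp only [nagata, Fin.prod_univ_succ, Fin.sum_univ_succ, map_mul, map_prod, map_pow,
    MvPolynomial.aeval_C, MvPolynomial.aeval_X, if_pos, Fin.succ_ne_zero,
    ite_false, map_add, finSuccEquiv_X_zero, finSuccEquiv_X_succ, algebraMap_eq]
  have h (i : Fin n) : (Polynomial.C (X (R := k) i) + Polynomial.X ^ N ^ (i.succ : ℕ)) ^ v i.succ
      ≠ 0 := by
    rw [add_comm]
    by_cases h0 : N ^ (i.succ : ℕ) = 0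
    · rw [h0, pow_zero]
      refine pow_ne_zero _ fun h1 => ?_
      rw [← Polynomial.C_1, ← Polynomial.C_add, Polynomial.C_eq_zero] at h1
      have h2 := congrArg (MvPolynomial.eval 0) h1
      simp at h2
    · exact pow_ne_zero _ (Polynomial.monic_X_pow_add_C _ h0).ne_zero
  rw [Polynomial.natDegree_mul (by simp [ha]) (mul_ne_zero (by simp) (Finset.prod_ne_zero_iff.mpr
    (fun i _ ↦ h i))), Polynomial.natDegree_mul (by simp)
    (Finset.prod_ne_zero_iff.mpr (fun i _ ↦ h i)),
    Polynomial.natDegree_prod _ _ (fun i _ ↦ h i), natDegree_finSuccEquiv, degreeOf_C]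
  simpa only [Polynomial.natDegree_pow, zero_add, Polynomial.natDegree_X, mul_one, Fin.val_zero,
    pow_zero, one_mul, add_right_inj] using Finset.sum_congr rfl (fun i _ ↦ by
    rw [add_comm (Polynomial.C _), Polynomial.natDegree_X_pow_add_C, mul_comm])

lemma leadingCoeff_finSuccEquiv_nagata (hN : N ≠ 0) (v : Fin (n + 1) →₀ ℕ) (a : k) :
    (finSuccEquiv k n (nagata k n N (monomial v a))).leadingCoeff = C a := by
  rw [monomial_eq, Finsupp.prod_fintype]
  · have hX : ∀ j, (finSuccEquiv k n (nagata k n N (X j))).leadingCoeff = 1 := fun j ↦ by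
      refine Fin.cases ?_ (fun i => ?_) j
      · simp [nagata, finSuccEquiv_X_zero]
      · simp only [nagata, MvPolynomial.aeval_X, Fin.succ_ne_zero, if_false, map_add, map_pow,
          finSuccEquiv_X_succ, finSuccEquiv_X_zero]
        rw [add_comm]
        exact (Polynomial.monic_X_pow_add_C _ (pow_ne_zero _ hN)).leadingCoeff
    have hC : finSuccEquiv k n (nagata k n N (C a)) = Polynomial.C (C a) := by
      rw [← algebraMap_eq, AlgHom.commutes, AlgEquiv.commutes]
      rfl
    simp only [map_mul, map_prod, map_pow, Polynomial.leadingCoeff_mul,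
      Polynomial.leadingCoeff_prod, Polynomial.leadingCoeff_pow, hX, hC, Polynomial.leadingCoeff_C,
      one_pow, Finset.prod_const_one, mul_one]
  exact fun i ↦ pow_zero _

/-- The substitution `nagata` makes a nonzero polynomial monic in `X₀`, up to a constant. -/
lemma exists_leadingCoeff_nagata {f : MvPolynomial (Fin (n + 1)) k} (hf : f ≠ 0) :
    ∃ (N : ℕ) (a : k), a ≠ 0 ∧ (finSuccEquiv k n (nagata k n N f)).leadingCoeff = C a := by
  set N := 2 + f.totalDegree with hN
  obtain ⟨v, hv, hmax⟩ := Finset.exists_max_image f.support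
    (fun v ↦ (nagata k n N (monomial v (coeff v f))).degreeOf 0) (support_nonempty.mpr hf)
  have hlt : ∀ w ∈ f.support, ∀ i, w i < N := fun w hw i =>
    lt_of_le_of_lt ((monomial_le_degreeOf i hw).trans (degreeOf_le_totalDegree f i)) (by omega)
  set h := fun w ↦ finSuccEquiv k n (nagata k n N (monomial w (coeff w f))) with hh
  have hlc : (h v).leadingCoeff = C (coeff v f) :=
    leadingCoeff_finSuccEquiv_nagata (by omega) v _
  have hdeg : ∀ x ∈ f.support \ {v}, (h x).degree < (h v).degree := by
    intro x hx
    obtain ⟨hx1, hx2⟩ := Finset.mem_sdiff.mp hx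
    refine Polynomial.degree_lt_degree ?_
    simp only [hh, natDegree_finSuccEquiv]
    refine lt_of_le_of_ne (hmax x hx1) ?_
    rw [degreeOf_zero_nagata _ (mem_support_iff.mp hx1),
      degreeOf_zero_nagata _ (mem_support_iff.mp hv)]
    exact sum_pow_mul_ne (by omega) (hlt x hx1) (hlt v hv) fun h0 => hx2 (by simp [h0])
  refine ⟨N, coeff v f, mem_support_iff.1 hv, ?_⟩
  have hsum : finSuccEquiv k n (nagata k n N f) = ∑ x ∈ f.support \ {v}, h x + h v := by
    conv_lhs => rw [← f.support_sum_monomial_coeff]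
    rw [Finset.sum_eq_add_sum_sdiff_singleton_of_mem hv, map_add, map_sum, map_add, map_sum,
      add_comm]
  have hv0 : h v ≠ 0 := fun h0 => by
    rw [h0, Polynomial.leadingCoeff_zero, eq_comm, C_eq_zero] at hlc
    exact mem_support_iff.1 hv hlc
  rw [hsum, Polynomial.leadingCoeff_add_of_degree_lt, hlc]
  exact (Polynomial.degree_sum_le _ _).trans_lt
    ((Finset.sup_lt_iff (Ne.bot_lt fun x ↦ hv0 (Polynomial.degree_eq_bot.mp x))).mpr hdeg)

end Nagata

section Preparation

variable {K : Type} [NormedField K] [CompleteSpace K] [IsAlgClosed K] [IsUltrametricDist K]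
variable {m : ℕ}

/-- The substitution `X₀ ↦ X₀`, `Xᵢ ↦ Xᵢ + e X₀ ^ (N ^ i)` in strictly convergent series. -/
def nagataHom (K : Type) [NormedField K] [CompleteSpace K] [IsAlgClosed K] [IsUltrametricDist K]
    (m N : ℕ) (e : TateAlgR K (m + 1)) : TateAlgR K (m + 1) →ₐ[Ro K] TateAlgR K (m + 1) :=
  substR fun i => if i = 0 then coordR 0 else coordR i + e * coordR 0 ^ N ^ (i : ℕ)

lemma unitBall_ext {x y : UnitBall K m} (h : ∀ i, toRo x i = toRo y i) : x = y :=
  Subtype.ext (funext fun i => congrArg Subtype.val (h i))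

lemma nagataHom_comp (N : ℕ) {e e' : Ro K} (h : e + e' = 0) :
    (nagataHom K m N (algebraMap _ _ e)).comp (nagataHom K m N (algebraMap _ _ e')) =
      AlgHom.id _ _ := by
  ext1 f
  refine evalR_ext fun x => ?_
  simp only [AlgHom.comp_apply, nagataHom, evalR_substR]
  change evalR _ f = evalR x f
  refine congrArg (fun y => evalR y f) (unitBall_ext fun i => ?_)
  by_cases hi : i = 0
  · subst hi
    simp [toRo_ballMap]
  · simp only [hi, if_false, map_add, map_mul, map_pow, evalR_coordR, toRo_ballMap,
      AlgHom.commutes, if_true, Algebra.algebraMap_self, RingHom.id_apply]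
    linear_combination (toRo x 0 ^ N ^ (i : ℕ)) * h

/-- `nagataHom` as an automorphism. -/
def nagataEquiv (K : Type) [NormedField K] [CompleteSpace K] [IsAlgClosed K]
    [IsUltrametricDist K] (m N : ℕ) : TateAlgR K (m + 1) ≃ₐ[Ro K] TateAlgR K (m + 1) :=
  AlgEquiv.ofAlgHom (nagataHom K m N (algebraMap _ _ 1)) (nagataHom K m N (algebraMap _ _ (-1)))
    (nagataHom_comp N (by ring)) (nagataHom_comp N (by ring))

lemma nagataEquiv_polyR (N : ℕ) (p : MvPolynomial (Fin (m + 1)) (Ro K)) :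
    nagataEquiv K m N (polyR K (m + 1) p) = polyR K (m + 1) (nagata (Ro K) m N p) := by
  refine evalR_ext fun x => ?_
  change evalR x (substR _ _) = _
  rw [evalR_substR, evalR_polyR, evalR_polyR, nagata, ← MvPolynomial.coe_aeval_eq_eval,
    ← MvPolynomial.coe_aeval_eq_eval]
  change _ = ((MvPolynomial.aeval (toRo x)).comp (MvPolynomial.aeval _)) p
  rw [MvPolynomial.comp_aeval]
  change MvPolynomial.aeval _ p = _
  congr 2
  ext1 i
  rw [toRo_ballMap]
  by_cases hi : i = 0
  · simp [hi]
  · simp [hi]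

lemma map_nagata {A B : Type} [CommRing A] [CommRing B] (φ : A →+* B) (n N : ℕ)
    (p : MvPolynomial (Fin (n + 1)) A) :
    MvPolynomial.map φ (nagata A n N p) = nagata B n N (MvPolynomial.map φ p) := by
  induction p using MvPolynomial.induction_on with
  | C a =>
    rw [← MvPolynomial.algebraMap_eq, AlgHom.commutes, MvPolynomial.algebraMap_eq,
      MvPolynomial.map_C, ← MvPolynomial.algebraMap_eq, AlgHom.commutes]
  | add p q hp hq => simp only [map_add, hp, hq]
  | mul_X p i hp =>
    simp only [map_mul, hp, MvPolynomial.map_X]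
    congr 1
    by_cases hi : i = 0 <;> simp [nagata, hi]

lemma map_finSuccEquiv {A B : Type} [CommRing A] [CommRing B] (φ : A →+* B) (n : ℕ)
    (p : MvPolynomial (Fin (n + 1)) A) :
    (MvPolynomial.finSuccEquiv A n p).map (MvPolynomial.map φ) =
      MvPolynomial.finSuccEquiv B n (MvPolynomial.map φ p) := by
  induction p using MvPolynomial.induction_on with
  | C a =>
    rw [MvPolynomial.map_C, ← MvPolynomial.algebraMap_eq, AlgEquiv.commutes,
      ← MvPolynomial.algebraMap_eq, AlgEquiv.commutes]
    change (Polynomial.C (MvPolynomial.C a)).map _ = Polynomial.C (MvPolynomial.C (φ a))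
    simp
  | add p q hp hq => simp only [map_add, Polynomial.map_add, hp, hq]
  | mul_X p i hp =>
    simp only [map_mul, Polynomial.map_mul, hp, MvPolynomial.map_X]
    congr 1
    refine Fin.cases ?_ (fun j => ?_) i
    · simp [MvPolynomial.finSuccEquiv_X_zero]
    · simp [MvPolynomial.finSuccEquiv_X_succ]

lemma exists_eq_smul_of_map_mk_eq_zero (hK : ∃ a : K, a ≠ 0 ∧ ‖a‖ < 1)
    {q : MvPolynomial (Fin m) (Ro K)} (hq : MvPolynomial.map (Ideal.Quotient.mk (RoMax K)) q = 0) :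
    ∃ (ϖ : Ro K) (q' : MvPolynomial (Fin m) (Ro K)), ϖ ≠ 0 ∧ ϖ ∈ RoMax K ∧ q = ϖ • q' := by
  have hmem : ∀ d, q.coeff d ∈ RoMax K := fun d => by
    rw [← Ideal.Quotient.eq_zero_iff_mem, ← MvPolynomial.coeff_map, hq, MvPolynomial.coeff_zero]
  obtain ⟨ρ, hρ, hle⟩ : ∃ ρ < (1 : ℝ), ∀ d, ‖((q.coeff d : Ro K) : K)‖ ≤ ρ := by
    rcases q.support.eq_empty_or_nonempty with h0 | hne
    · rw [MvPolynomial.support_eq_empty] at h0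
      exact ⟨0, zero_lt_one, fun d => by simp [h0]⟩
    · obtain ⟨d, hd, hmax⟩ := Finset.exists_max_image q.support
        (fun d => ‖((q.coeff d : Ro K) : K)‖) hne
      refine ⟨_, hmem d, fun e => ?_⟩
      by_cases he : e ∈ q.support
      · exact hmax e he
      · simp [MvPolynomial.notMem_support_iff.1 he]
  obtain ⟨ϖ, h0, h1, h2⟩ := exists_norm_lt_one_gt hK hρ
  obtain ⟨q', hq'⟩ := (MvPolynomial.C_dvd_iff_dvd_coeff ϖ q).2 fun d =>
    Ro.dvd_of_norm_le ((hle d).trans h2)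
  exact ⟨ϖ, q', h0, h1, by rw [hq', MvPolynomial.smul_eq_C_mul]⟩

/-- After a change of coordinates and up to a constant, a nonzero series is congruent to a monic
polynomial in the first variable modulo a topologically nilpotent constant. -/
lemma exists_preparation (hK : ∃ a : K, a ≠ 0 ∧ ‖a‖ < 1) {f : TateAlgR K (m + 1)} (hf : f ≠ 0) :
    ∃ (τ : TateAlgR K (m + 1) ≃ₐ[Ro K] TateAlgR K (m + 1)) (c ϖ : Ro K)
      (ω : Polynomial (TateAlgR K m)) (f₁ : TateAlgR K (m + 1)),
      c ≠ 0 ∧ ϖ ≠ 0 ∧ ϖ ∈ RoMax K ∧ ω.Monic ∧ τ f = c • (iotaR K m ω + ϖ • f₁) := by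
  obtain ⟨c, ϖ₁, p, g, hc, hϖ₁0, hϖ₁, hp, rfl⟩ := exists_eq_smul_polyR_add_smul hK hf
  obtain ⟨N, a, ha, hlc⟩ := exists_leadingCoeff_nagata hp
  obtain ⟨u, rfl⟩ := Ideal.Quotient.mk_surjective a
  have hu : IsUnit u := Ro.isUnit_of_norm_eq_one
    (Ro.norm_eq_one_of_notMem fun h => ha (Ideal.Quotient.eq_zero_iff_mem.2 h))
  obtain ⟨v, hv⟩ := hu.exists_right_inv
  set P := MvPolynomial.finSuccEquiv (Ro K) m (v • nagata (Ro K) m N p) with hP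
  have hPmap : P.map (MvPolynomial.map (Ideal.Quotient.mk (RoMax K))) =
      Polynomial.C (MvPolynomial.C (Ideal.Quotient.mk (RoMax K) v)) *
        MvPolynomial.finSuccEquiv _ m (nagata _ m N
          (MvPolynomial.map (Ideal.Quotient.mk (RoMax K)) p)) := by
    rw [hP, map_finSuccEquiv, MvPolynomial.smul_eq_C_mul, map_mul, map_nagata, map_mul,
      MvPolynomial.map_C]
    congr 1
    rw [← MvPolynomial.algebraMap_eq, AlgEquiv.commutes]
    rfl
  have hmonic : (P.map (MvPolynomial.map (Ideal.Quotient.mk (RoMax K)))).Monic := by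
    rw [Polynomial.Monic, hPmap, Polynomial.leadingCoeff_mul, hlc, Polynomial.leadingCoeff_C,
      ← map_mul, ← map_mul, mul_comm, hv, map_one, map_one]
  obtain ⟨ω₀, hω₀, -, hω₀m⟩ := Polynomial.lifts_and_natDegree_eq_and_monic
    (Polynomial.mem_lifts _ |>.2 ⟨P, rfl⟩) hmonic
  set w := (MvPolynomial.finSuccEquiv (Ro K) m).symm ω₀ with hw
  have hww : MvPolynomial.finSuccEquiv (Ro K) m w = ω₀ := AlgEquiv.apply_symm_apply _ _
  obtain ⟨ϖ₂, q, hϖ₂0, hϖ₂, hq⟩ := exists_eq_smul_of_map_mk_eq_zero hK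
    (q := v • nagata (Ro K) m N p - w) (by
      refine (MvPolynomial.finSuccEquiv _ m).injective ?_
      rw [← map_finSuccEquiv, map_sub, Polynomial.map_sub, ← hP, hww, hω₀, sub_self, map_zero])
  obtain ⟨ϖ, h0, h1, h2⟩ := exists_norm_lt_one_gt hK (max_lt hϖ₁ hϖ₂)
  obtain ⟨a₁, rfl⟩ := Ro.dvd_of_norm_le ((le_max_left _ _).trans h2)
  obtain ⟨a₂, rfl⟩ := Ro.dvd_of_norm_le ((le_max_right _ _).trans h2)
  refine ⟨nagataEquiv K m N, c * u, ϖ, ω₀.map (polyR K m).toRingHom,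
    a₂ • polyR K (m + 1) q + v • a₁ • nagataEquiv K m N g, mul_ne_zero hc hu.ne_zero, h0, h1,
    hω₀m.map _, ?_⟩
  have h3 := iotaR_finSuccEquiv w
  rw [hww] at h3
  have h4 := congrArg (polyR K (m + 1)) hq
  rw [map_sub, map_smul, map_smul] at h4
  have h5 : algebraMap (Ro K) (TateAlgR K (m + 1)) u * algebraMap _ _ v = 1 := by
    rw [← map_mul, hv, map_one]
  rw [map_smul, map_add, map_smul, nagataEquiv_polyR, h3]
  simp only [Algebra.smul_def, map_mul] at h4 ⊢
  linear_combination (-algebraMap (Ro K) (TateAlgR K (m + 1)) c) *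
    (polyR K (m + 1) (nagata (Ro K) m N p) + algebraMap _ _ ϖ * algebraMap _ _ a₁ *
      nagataEquiv K m N g) * h5 + algebraMap (Ro K) (TateAlgR K (m + 1)) c * algebraMap _ _ u * h4

/-- After a change of coordinates and up to a constant, a nonzero series divides a monic
polynomial in the first variable. -/
lemma exists_weierstrass (hK : ∃ a : K, a ≠ 0 ∧ ‖a‖ < 1) {f : TateAlgR K (m + 1)} (hf : f ≠ 0) :
    ∃ (τ : TateAlgR K (m + 1) ≃ₐ[Ro K] TateAlgR K (m + 1)) (c : Ro K)
      (ω : Polynomial (TateAlgR K m)) (F q : TateAlgR K (m + 1)),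
      c ≠ 0 ∧ ω.Monic ∧ τ f = c • F ∧ q * F = iotaR K m ω := by
  obtain ⟨τ, c, ϖ, ω, f₁, hc, h0, h1, hω, h⟩ := exists_preparation hK hf
  obtain ⟨q, ω', hω', hq⟩ := exists_mul_eq_iotaR h0 h1 hω rfl
  exact ⟨τ, c, ω', _, q, hc, hω', h, hq⟩

lemma exists_division_iotaR (hK : ∃ a : K, a ≠ 0 ∧ ‖a‖ < 1) {ω : Polynomial (TateAlgR K m)}
    (hω : ω.Monic) (g : TateAlgR K (m + 1)) :
    ∃ (q : TateAlgR K (m + 1)) (r : Polynomial (TateAlgR K m)),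
      r.degree < ω.degree ∧ g = q * iotaR K m ω + iotaR K m r := by
  obtain ⟨ϖ, h0, h1, -⟩ := exists_norm_lt_one_gt hK zero_lt_one
  exact exists_division h0 h1 hω (f₁ := 0) (by simp) g

end Preparation

end RigidQE
end

noncomputable section
namespace RigidQE

open Polynomial

section Normal

variable {K : Type} [NormedField K] [CompleteSpace K] [IsAlgClosed K] [IsUltrametricDist K]
variable {m : ℕ}

/-- Points of `R⟨S₁,…,Sₘ⟩` with values in `R` are evaluations. -/
lemma algHom_eq_evalR (hK : ∃ a : K, a ≠ 0 ∧ ‖a‖ < 1) (ψ : TateAlgR K m →ₐ[Ro K] Ro K) :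
    ∃ x : UnitBall K m, ψ = evalR x := by
  refine ⟨ofRo fun i => ψ (coordR i), ?_⟩
  set x : UnitBall K m := ofRo fun i => ψ (coordR i)
  have hpoly : ∀ p, ψ (polyR K m p) = evalR x (polyR K m p) := fun p => by
    have : ψ.comp (polyR K m) = (evalR x).comp (polyR K m) := by
      refine MvPolynomial.algHom_ext fun i => ?_
      simp only [AlgHom.comp_apply, polyR, MvPolynomial.aeval_X]
      rfl
    exact DFunLike.congr_fun this p
  ext1 f
  by_contra hne
  obtain ⟨ϖ, h0, h1, -⟩ := exists_norm_lt_one_gt hK zero_lt_one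
  have hd : ψ f - evalR x f ≠ 0 := sub_ne_zero.2 hne
  obtain ⟨p, g, hf⟩ := exists_eq_polyR_add_smul (mul_ne_zero h0 hd) f
  have h2 : ψ f - evalR x f = ϖ * (ψ f - evalR x f) * (ψ g - evalR x g) := by
    conv_lhs => rw [hf]
    rw [map_add, map_add, hpoly, map_smul, map_smul, smul_eq_mul, smul_eq_mul]
    ring
  have h3 : (ψ f - evalR x f) * (1 - ϖ * (ψ g - evalR x g)) = 0 := by
    linear_combination h2
  rcases mul_eq_zero.1 h3 with h | h
  · exact hd h
  · have : ϖ * (ψ g - evalR x g) ∈ RoMax K := Ideal.mul_mem_right _ _ h1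
    rw [← sub_eq_zero.1 h] at this
    exact (Ideal.ne_top_iff_one _).1 (RoMax_isMaximal (K := K)).ne_top this

lemma norm_evalR_map_le (hK : ∃ a : K, a ≠ 0 ∧ ‖a‖ < 1)
    (τ : TateAlgR K m ≃ₐ[Ro K] TateAlgR K m) {f g : TateAlgR K m}
    (h : ∀ x, ‖(evalR x g : K)‖ ≤ ‖(evalR x f : K)‖) (x : UnitBall K m) :
    ‖(evalR x (τ g) : K)‖ ≤ ‖(evalR x (τ f) : K)‖ := by
  obtain ⟨y, hy⟩ := algHom_eq_evalR hK ((evalR x).comp τ.toAlgHom)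
  have hy' : ∀ a, evalR x (τ a) = evalR y a := DFunLike.congr_fun hy
  rw [hy', hy']
  exact h y

lemma iotaR_ne_zero (hK : ∃ a : K, a ≠ 0 ∧ ‖a‖ < 1) {ω : (TateAlgR K m)[X]} (hω : ω.Monic) :
    iotaR K m ω ≠ 0 := fun h => hω.ne_zero <|
  eq_zero_of_norm_iotaR_le hK 1 (monic_X.mul hω)
    (by
      rw [hω.degree_mul, degree_X, degree_eq_natDegree hω.ne_zero]
      exact_mod_cast Nat.lt_one_add_iff.2 le_rfl)
    fun x => by rw [h, map_mul, h, mul_zero]; simp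

/-- `R⟨⟩ = R`. -/
lemma TateAlgR.exists_eq_algebraMap (f : TateAlgR K 0) : ∃ a : Ro K, f = algebraMap _ _ a :=
  ⟨evalR (ofRo 0) f, evalR_ext fun x => by
    rw [AlgHom.commutes, unitBall_ext (x := x) (y := ofRo 0) fun i => i.elim0]
    rfl⟩

theorem tateAlgR_isDomain (hK : ∃ a : K, a ≠ 0 ∧ ‖a‖ < 1) : IsDomain (TateAlgR K m) := by
  have : NoZeroDivisors (TateAlgR K m) := by
    refine ⟨fun {f g} hfg => ?_⟩
    by_contra! hne
    obtain ⟨c, ϖ, p, f₁, hc, -, hϖ, hp, hf⟩ := exists_eq_smul_polyR_add_smul hK hne.1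
    obtain ⟨d, ϖ', p', g₁, hd, -, hϖ', hp', hg⟩ := exists_eq_smul_polyR_add_smul hK hne.2
    obtain ⟨x, hx⟩ := exists_norm_eval_eq_one (p := p * p')
      (by rw [map_mul]; exact mul_ne_zero hp hp')
    have h0 := congrArg (evalR x) hfg
    have h1 : evalR x (polyR K m p + ϖ • f₁) * evalR x (polyR K m p' + ϖ' • g₁) = 0 := by
      rw [hf, hg, map_mul, map_smul, map_smul, map_zero, smul_eq_mul, smul_eq_mul,
        mul_mul_mul_comm] at h0
      exact (mul_eq_zero.1 h0).resolve_left (mul_ne_zero hc hd)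
    have h2 : evalR x (polyR K m (p * p')) ∈ RoMax K := by
      have h3 : evalR x (polyR K m (p * p')) =
          ϖ * (-(evalR x f₁ * evalR x (polyR K m p' + ϖ' • g₁))) +
            ϖ' * (-(evalR x g₁ * evalR x (polyR K m p))) := by
        simp only [map_add, map_mul, map_smul, smul_eq_mul] at h1 ⊢
        linear_combination h1
      rw [h3]
      exact add_mem (Ideal.mul_mem_right _ _ hϖ) (Ideal.mul_mem_right _ _ hϖ')
    exact (mem_RoMax_iff.1 h2).ne hx
  exact NoZeroDivisors.to_isDomain _

/-- Divisibility in `R⟨S₁,…,Sₘ⟩` is detected pointwise. -/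
theorem TateAlgR.dvd_of_norm_evalR_le (hK : ∃ a : K, a ≠ 0 ∧ ‖a‖ < 1) {f g : TateAlgR K m}
    (hf : f ≠ 0) (h : ∀ x, ‖(evalR x g : K)‖ ≤ ‖(evalR x f : K)‖) : f ∣ g := by
  cases m with
  | zero =>
    obtain ⟨a, rfl⟩ := TateAlgR.exists_eq_algebraMap f
    obtain ⟨b, rfl⟩ := TateAlgR.exists_eq_algebraMap g
    have h0 := h (ofRo 0)
    rw [AlgHom.commutes, AlgHom.commutes] at h0
    exact map_dvd _ (Ro.dvd_of_norm_le h0)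
  | succ m =>
    have := tateAlgR_isDomain (m := m + 1) hK
    obtain ⟨τ, c, ω, F, q, hc, hω, hτ, hq⟩ := exists_weierstrass hK hf
    have hle : ∀ x, ‖(evalR x (τ g) : K)‖ ≤ ‖(c : K)‖ * ‖(evalR x F : K)‖ := fun x => by
      refine (norm_evalR_map_le hK τ h x).trans_eq ?_
      rw [hτ, map_smul, smul_eq_mul, Subring.coe_mul, norm_mul]
    obtain ⟨g₁, hg₁⟩ := TateAlgR.dvd_of_norm_le hc (f := τ g) fun x =>
      (hle x).trans (mul_le_of_le_one_right (norm_nonneg _) (evalR x F).2)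
    have hle₁ : ∀ x, ‖(evalR x g₁ : K)‖ ≤ ‖(evalR x F : K)‖ := fun x => by
      have h1 := hle x
      rw [hg₁, map_smul, smul_eq_mul, Subring.coe_mul, norm_mul] at h1
      exact le_of_mul_le_mul_left h1 (norm_pos_iff.2 fun h0 => hc (Subtype.ext h0))
    obtain ⟨q', r, hr, hd⟩ := exists_division_iotaR hK hω (q * g₁)
    have hr0 : r = 0 := by
      refine eq_zero_of_norm_iotaR_le hK 1 hω hr fun x => ?_
      rw [one_mul, eq_sub_of_add_eq' hd.symm, map_sub, map_mul, map_mul, AddSubgroupClass.coe_sub,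
        Subring.coe_mul, Subring.coe_mul, sub_eq_add_neg]
      refine (IsUltrametricDist.norm_add_le_max _ _).trans (max_le ?_ ?_)
      · rw [← hq, map_mul, Subring.coe_mul, norm_mul, norm_mul]
        exact mul_le_mul_of_nonneg_left (hle₁ x) (norm_nonneg _)
      · rw [norm_neg, norm_mul]
        exact mul_le_of_le_one_left (norm_nonneg _) (evalR x q').2
    have hq0 : q ≠ 0 := by
      rintro rfl
      rw [zero_mul] at hq
      exact iotaR_ne_zero hK hω hq.symm
    have hdvd : F ∣ g₁ := by
      refine ⟨q', mul_left_cancel₀ hq0 ?_⟩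
      rw [hd, hr0, map_zero, ← hq]
      ring
    obtain ⟨a, ha⟩ := hdvd
    have h2 : τ f ∣ τ g := ⟨a, by rw [hg₁, hτ, ha, smul_mul_assoc]⟩
    simpa using map_dvd τ.symm h2

theorem tateAlgR_isIntegrallyClosed (hK : ∃ a : K, a ≠ 0 ∧ ‖a‖ < 1) :
    IsIntegrallyClosed (TateAlgR K m) := by
  have := tateAlgR_isDomain (m := m) hK
  rw [isIntegrallyClosed_iff (FractionRing (TateAlgR K m))]
  rintro z ⟨p, hp, hpz⟩
  obtain ⟨g, f, hf, rfl⟩ := IsFractionRing.div_surjective (A := TateAlgR K m) z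
  have hf0 : f ≠ 0 := nonZeroDivisors.ne_zero hf
  have hinj := IsFractionRing.injective (TateAlgR K m) (FractionRing (TateAlgR K m))
  have h0 := scaleRoots_aeval_eq_zero_of_aeval_div_eq_zero hinj (p := p) hpz hf
  rw [aeval_algebraMap_apply_eq_algebraMap_eval, map_eq_zero_iff _ hinj] at h0
  obtain ⟨a, rfl⟩ := TateAlgR.dvd_of_norm_evalR_le hK hf0 (g := g) fun x => by
    have hpx : (p.map (evalR x).toRingHom).Monic := hp.map _
    have h1 : ((p.map (evalR x).toRingHom).scaleRoots (evalR x f)).eval (evalR x g) = 0 := by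
      have h2 := congrArg (evalR x).toRingHom h0
      rw [map_zero, ← eval_map_apply, map_scaleRoots _ _ _ (by simp [hp.leadingCoeff])] at h2
      exact h2
    set px := p.map (evalR x).toRingHom
    by_cases hfx : evalR x f = 0
    · rw [hfx, scaleRoots_zero, hpx.leadingCoeff, one_smul, eval_pow, eval_X] at h1
      simp [eq_zero_of_pow_eq_zero h1]
    have hfx' : (evalR x f : K) ≠ 0 := fun h => hfx (Subtype.ext h)
    have h3 := scaleRoots_eval₂_mul (p := px) (algebraMap (Ro K) K)
      ((evalR x g : K) / (evalR x f : K)) (evalR x f)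
    have h4 : algebraMap (Ro K) K (evalR x f) * ((evalR x g : K) / (evalR x f : K)) =
      algebraMap (Ro K) K (evalR x g) := mul_div_cancel₀ _ hfx'
    rw [h4, eval₂_at_apply, h1, map_zero, eq_comm, mul_eq_zero] at h3
    have h5 := norm_le_one_of_root hpx (h3.resolve_left (pow_ne_zero _ hfx'))
    rwa [norm_div, div_le_one (norm_pos_iff.2 hfx')] at h5
  refine ⟨a, ?_⟩
  rw [map_mul, mul_div_cancel_left₀]
  exact (map_ne_zero_iff _ hinj).2 hf0

/-- Noether normalization. -/
theorem exists_noether_normalization (hK : ∃ a : K, a ≠ 0 ∧ ‖a‖ < 1) (m : ℕ) {B : Type}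
    [CommRing B] [IsDomain B] [Algebra (Ro K) B]
    (hinj : Function.Injective (algebraMap (Ro K) B)) (π : TateAlgR K m →ₐ[Ro K] B)
    (hπ : Function.Surjective π) :
    ∃ (d : ℕ) (φ : TateAlgR K d →ₐ[Ro K] B), Function.Injective φ ∧
      φ.toRingHom.IsIntegral := by
  induction m generalizing B with
  | zero =>
    refine ⟨0, π, (injective_iff_map_eq_zero π).2 fun f hf => ?_,
      RingHom.isIntegral_of_surjective _ hπ⟩
    obtain ⟨a, rfl⟩ := TateAlgR.exists_eq_algebraMap f
    rw [AlgHom.commutes, map_eq_zero_iff _ hinj] at hf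
    rw [hf, map_zero]
  | succ m ih =>
    by_cases hπi : Function.Injective π
    · exact ⟨m + 1, π, hπi, RingHom.isIntegral_of_surjective _ hπ⟩
    obtain ⟨f, hf, hf0⟩ : ∃ f, π f = 0 ∧ f ≠ 0 := by
      rw [injective_iff_map_eq_zero] at hπi
      simpa using hπi
    obtain ⟨τ, c, ω, F, q, hc, hω, hτ, hq⟩ := exists_weierstrass hK hf0
    set σ := π.comp τ.symm.toAlgHom with hσ
    have hσs : Function.Surjective σ := hπ.comp τ.symm.surjective
    have hσF : σ F = 0 := by
      have h1 : σ (τ f) = 0 := by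
        change π (τ.symm (τ f)) = 0
        rw [AlgEquiv.symm_apply_apply, hf]
      rw [hτ, map_smul, Algebra.smul_def] at h1
      exact (mul_eq_zero.1 h1).resolve_left ((map_ne_zero_iff _ hinj).2 hc)
    have hσω : σ (iotaR K m ω) = 0 := by rw [← hq, map_mul, hσF, mul_zero]
    set ρ := σ.comp (tailR K m) with hρ
    obtain ⟨d, φ, hφ, hφi⟩ := ih (B := ρ.range)
      (fun a b hab => hinj (congrArg Subtype.val hab)) ρ.rangeRestrict ρ.rangeRestrict_surjective
    have hσι : ∀ r, σ (iotaR K m r) = aeval (σ (coordR 0)) (r.map ρ.rangeRestrict.toRingHom) :=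
      fun r => by
        rw [aeval_def, eval₂_map]
        exact hom_eval₂ r (tailR K m).toRingHom σ.toRingHom (coordR 0)
    have hx : IsIntegral ρ.range (σ (coordR 0)) :=
      ⟨ω.map ρ.rangeRestrict.toRingHom, hω.map _, by rw [← hσω, hσι]; rfl⟩
    have hB : (algebraMap ρ.range B).IsIntegral := fun b => by
      obtain ⟨g, rfl⟩ := hσs b
      obtain ⟨q', r, -, hg⟩ := exists_division_iotaR hK hω g
      rw [hg, map_add, map_mul, hσω, mul_zero, zero_add, hσι, aeval_eq_sum_range]
      exact IsIntegral.sum _ fun i _ => (hx.pow i).smul _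
    exact ⟨d, ρ.range.val.comp φ, Subtype.val_injective.comp hφ,
      RingHom.IsIntegral.trans φ.toRingHom (algebraMap ρ.range B) hφi hB⟩

end Normal

end RigidQE
end

noncomputable section
namespace RigidQE

section Points

open scoped TensorProduct

variable {K : Type} [NormedField K] [CompleteSpace K] [IsAlgClosed K] [IsUltrametricDist K]
variable {m : ℕ}

theorem exists_eq_polyR_add_smul_mem (f : TateAlgR K m) :
    ∃ c ∈ RoMax K, ∃ (p : MvPolynomial (Fin m) (Ro K)) (g : TateAlgR K m),
      f = polyR K m p + c • g := by
  by_cases hK : ∃ a : K, a ≠ 0 ∧ ‖a‖ < 1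
  · obtain ⟨c, hc, hcm, -⟩ := exists_norm_lt_one_gt hK zero_lt_one
    exact ⟨c, hcm, exists_eq_polyR_add_smul hc f⟩
  push Not at hK
  refine ⟨0, (RoMax K).zero_mem, ?_⟩
  simp only [zero_smul, add_zero, exists_const]
  obtain h0 | h0 := (norm_nonneg f.1).eq_or_lt
  · exact ⟨0, by rw [map_zero]; exact Subtype.ext (norm_eq_zero.1 h0.symm)⟩
  obtain ⟨c, q, -, hq, hfc, -⟩ := exists_approx f.1 f.2.1
    (ε := min (1 / 2) (‖f.1‖ / 2)) (lt_min one_half_pos (half_pos h0))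
    ((min_le_right _ _).trans_lt (half_lt_self h0))
  refine ⟨(⟨c, (hfc ▸ f.2.2 : ‖c‖ ≤ 1)⟩ : Ro K) • q, evalR_ext fun x => Subtype.ext ?_⟩
  rw [map_smul, coe_evalR, coe_evalR, smul_val_apply, ← coe_evalR x (polyR K m q)]
  refine sub_eq_zero.1 (by_contra fun h => ?_)
  exact absurd ((hq x).trans_le (min_le_left _ _)) (not_lt.2 (by linarith [hK _ h]))

/-- Maximal ideals of `R⟨S₁,…,Sₘ⟩` contain `℘`. -/
theorem TateAlgR.smul_mem_of_isMaximal (M : Ideal (TateAlgR K m)) [hM : M.IsMaximal] {c : Ro K}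
    (hc : c ∈ RoMax K) (f : TateAlgR K m) : c • f ∈ M := by
  by_contra h
  obtain ⟨g, i, hi, hgi⟩ := hM.exists_inv h
  refine hM.ne_top (M.eq_top_of_isUnit_mem hi ?_)
  rw [eq_sub_of_add_eq' hgi, mul_smul_comm]
  exact isUnit_one_sub_smul hc _

/-- The residue fields of `R⟨S₁,…,Sₘ⟩` at maximal ideals are the residue field of `R`. -/
theorem TateAlgR.exists_sub_algebraMap_mem (M : Ideal (TateAlgR K m)) [hM : M.IsMaximal]
    (f : TateAlgR K m) : ∃ a : Ro K, f - algebraMap (Ro K) _ a ∈ M := by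
  let _ : Field (TateAlgR K m ⧸ M) := Ideal.Quotient.field M
  let ψ : Ro K ⧸ RoMax K →+* TateAlgR K m ⧸ M :=
    Ideal.Quotient.lift (RoMax K) ((Ideal.Quotient.mk M).comp (algebraMap (Ro K) _))
      fun a ha => Ideal.Quotient.eq_zero_iff_mem.2 <| by
        simpa [Algebra.smul_def] using TateAlgR.smul_mem_of_isMaximal M ha 1
  let F : MvPolynomial (Fin m) (Ro K ⧸ RoMax K) →+* TateAlgR K m ⧸ M :=
    MvPolynomial.eval₂Hom ψ fun i => Ideal.Quotient.mk M (coordR i)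
  have hFC : F.comp MvPolynomial.C = ψ := RingHom.ext fun a => MvPolynomial.eval₂Hom_C _ _ _
  have hF : F.comp (MvPolynomial.map (Ideal.Quotient.mk (RoMax K))) =
      (Ideal.Quotient.mk M).comp (polyR K m).toRingHom := by
    refine MvPolynomial.ringHom_ext (fun a => ?_) fun i => ?_
    · simp [F, ψ]
    · simp [F, polyR]
  have hFs : Function.Surjective F := fun z => by
    obtain ⟨g, rfl⟩ := Ideal.Quotient.mk_surjective z
    obtain ⟨c, hc, p, g', rfl⟩ := exists_eq_polyR_add_smul_mem g
    refine ⟨MvPolynomial.map (Ideal.Quotient.mk (RoMax K)) p, ?_⟩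
    rw [map_add, Ideal.Quotient.eq_zero_iff_mem.2 (TateAlgR.smul_mem_of_isMaximal M hc g'),
      add_zero]
    exact RingHom.congr_fun hF p
  have hψ : ψ.IsIntegral :=
    hFC ▸ MvPolynomial.comp_C_integral_of_surjective_of_isJacobsonRing F hFs
  algebraize [ψ]
  obtain ⟨a, ha⟩ := (IsAlgClosed.algebraMap_bijective_of_isIntegral
    (k := Ro K ⧸ RoMax K) (K := TateAlgR K m ⧸ M)).2 (Ideal.Quotient.mk M f)
  obtain ⟨a, rfl⟩ := Ideal.Quotient.mk_surjective a
  exact ⟨a, Ideal.Quotient.eq.1 ha.symm⟩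

/-- Every maximal ideal of `R⟨S₁,…,Sₘ⟩` contains the ideal of some point. -/
theorem TateAlgR.exists_ker_evalR_le (M : Ideal (TateAlgR K m)) [hM : M.IsMaximal] :
    ∃ t : UnitBall K m, RingHom.ker (evalR t) ≤ M := by
  choose t ht using fun i => TateAlgR.exists_sub_algebraMap_mem M (coordR (K := K) (m := m) i)
  refine ⟨ofRo t, fun f hf => ?_⟩
  obtain ⟨c, hc, p, g, rfl⟩ := exists_eq_polyR_add_smul_mem f
  have h1 : (Ideal.Quotient.mk M).comp (polyR K m).toRingHom =
      ((Ideal.Quotient.mk M).comp (algebraMap (Ro K) _)).comp (MvPolynomial.eval t) := by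
    refine MvPolynomial.ringHom_ext (fun a => ?_) fun i => ?_
    · simp
    · simpa [polyR] using Ideal.Quotient.eq.2 (ht i)
  have h2 : MvPolynomial.eval t p ∈ RoMax K := by
    rw [RingHom.mem_ker, map_add, map_smul, evalR_polyR, toRo_ofRo] at hf
    rw [eq_neg_of_add_eq_zero_left hf, smul_eq_mul]
    exact neg_mem (Ideal.mul_mem_right _ _ hc)
  refine add_mem ?_ (TateAlgR.smul_mem_of_isMaximal M hc g)
  rw [← Ideal.Quotient.eq_zero_iff_mem]
  refine (RingHom.congr_fun h1 p).trans (Ideal.Quotient.eq_zero_iff_mem.2 ?_)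
  simpa [Algebra.smul_def] using TateAlgR.smul_mem_of_isMaximal M h2 1

variable {A0 : Type} [CommRing A0] [Algebra (Ro K) A0]

theorem IsTopFinType.algebraMap_mem (hA : IsTopFinType K A0) (I : Ideal A0) [I.IsMaximal]
    {c : Ro K} (hc : c ∈ RoMax K) : algebraMap (Ro K) A0 c ∈ I := by
  obtain ⟨m, π, hπ⟩ := hA
  have : (I.comap π).IsMaximal := Ideal.comap_isMaximal_of_surjective π hπ
  simpa [Algebra.smul_def] using TateAlgR.smul_mem_of_isMaximal (I.comap π) hc 1

theorem IsTopFinType.exists_sub_algebraMap_mem (hA : IsTopFinType K A0) (I : Ideal A0)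
    [I.IsMaximal] (f : A0) : ∃ a : Ro K, f - algebraMap (Ro K) _ a ∈ I := by
  obtain ⟨m, π, hπ⟩ := hA
  obtain ⟨f, rfl⟩ := hπ f
  have : (I.comap π).IsMaximal := Ideal.comap_isMaximal_of_surjective π hπ
  obtain ⟨a, ha⟩ := TateAlgR.exists_sub_algebraMap_mem (I.comap π) f
  exact ⟨a, by simpa using ha⟩

/-- A prime ideal complementary to the image of `R` is the kernel of a point. -/
theorem exists_algHom_of_forall_sub_mem (Q : Ideal A0)
    (h0 : ∀ a : Ro K, algebraMap (Ro K) A0 a ∈ Q → a = 0)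
    (h1 : ∀ f, ∃ a : Ro K, f - algebraMap (Ro K) A0 a ∈ Q) :
    ∃ y : A0 →ₐ[Ro K] Ro K, RingHom.ker y = Q := by
  have hb : Function.Bijective (Algebra.ofId (Ro K) (A0 ⧸ Q)) := by
    refine ⟨(injective_iff_map_eq_zero _).2 fun a ha => h0 a ?_, fun z => ?_⟩
    · exact Ideal.Quotient.eq_zero_iff_mem.1 ha
    · obtain ⟨f, rfl⟩ := Ideal.Quotient.mk_surjective z
      obtain ⟨a, ha⟩ := h1 f
      exact ⟨a, (Ideal.Quotient.eq.2 ha).symm⟩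
  refine ⟨(AlgEquiv.ofBijective _ hb).symm.toAlgHom.comp (Ideal.Quotient.mkₐ (Ro K) Q), ?_⟩
  ext f
  rw [RingHom.mem_ker, ← Ideal.Quotient.eq_zero_iff_mem]
  exact map_eq_zero_iff (AlgEquiv.ofBijective _ hb).symm (AlgEquiv.injective _)

/-- Every maximal ideal of `A°` contains the kernel of an `R`-valued point. -/
theorem IsTopFinType.exists_algHom_ker_le (hA : IsTopFinType K A0)
    (hflat : Module.Flat (Ro K) A0) (I : Ideal A0) [hI : I.IsMaximal] :
    ∃ y : A0 →ₐ[Ro K] Ro K, RingHom.ker y ≤ I := by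
  by_cases hK : ∃ a : K, a ≠ 0 ∧ ‖a‖ < 1
  swap
  · push Not at hK
    obtain ⟨y, hy⟩ := exists_algHom_of_forall_sub_mem I (fun a ha => by
      by_contra h
      have ha1 := (Ro.norm_le_one a).antisymm (hK a fun h' => h (Subtype.ext h'))
      exact hI.ne_top (I.eq_top_of_isUnit_mem ha ((Ro.isUnit_of_norm_eq_one ha1).map _)))
      (hA.exists_sub_algebraMap_mem I)
    exact ⟨y, hy.le⟩
  obtain ⟨Q₀, hQ₀, hQI⟩ := Ideal.exists_minimalPrimes_le (bot_le (a := I))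
  have hQ₀p : Q₀.IsPrime := hQ₀.1.1
  have hinj : Function.Injective (algebraMap (Ro K) (A0 ⧸ Q₀)) := by
    refine (injective_iff_map_eq_zero _).2 fun a ha => by_contra fun h => ?_
    refine Set.disjoint_left.1 (Ideal.disjoint_nonZeroDivisors_of_mem_minimalPrimes hQ₀)
      (Ideal.Quotient.eq_zero_iff_mem.1 ha) ?_
    have hreg := Module.Flat.isSMulRegular_of_nonZeroDivisors (M := A0)
      (mem_nonZeroDivisors_of_ne_zero h)
    refine mem_nonZeroDivisors_iff_right.2 fun x hx => ?_
    rw [mul_comm, ← Algebra.smul_def] at hx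
    exact hreg (by simpa using hx)
  obtain ⟨m, π, hπ⟩ := hA
  obtain ⟨d, φ, hφ, hφi⟩ := exists_noether_normalization hK m hinj
    ((Ideal.Quotient.mkₐ (Ro K) Q₀).comp π) (Ideal.Quotient.mk_surjective.comp hπ)
  set J := I.map (Ideal.Quotient.mk Q₀) with hJ
  have hJI : J.comap (Ideal.Quotient.mk Q₀) = I := by
    rw [hJ, Ideal.comap_map_of_surjective _ Ideal.Quotient.mk_surjective, ← RingHom.ker_eq_comap_bot,
      Ideal.mk_ker, sup_eq_left.2 hQI]
  have hJm : J.IsMaximal := by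
    refine (Ideal.map_eq_top_or_isMaximal_of_surjective _ Ideal.Quotient.mk_surjective
      hI).resolve_left fun h => hI.ne_top ?_
    rw [← hJI, hJ, h, Ideal.comap_top]
  have := tateAlgR_isDomain (m := d) hK
  have := tateAlgR_isIntegrallyClosed (m := d) hK
  let _ : Algebra (TateAlgR K d) (A0 ⧸ Q₀) := φ.toRingHom.toAlgebra
  have : FaithfulSMul (TateAlgR K d) (A0 ⧸ Q₀) := (faithfulSMul_iff_algebraMap_injective _ _).2 hφ
  have : Algebra.IsIntegral (TateAlgR K d) (A0 ⧸ Q₀) := ⟨hφi⟩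
  have : (J.under (TateAlgR K d)).IsMaximal := Ideal.isMaximal_comap_of_isIntegral_of_isMaximal J
  obtain ⟨t, ht⟩ := TateAlgR.exists_ker_evalR_le (J.under (TateAlgR K d))
  have : (RingHom.ker (evalR t)).IsPrime := RingHom.ker_isPrime _
  obtain ⟨Q, hQJ, hQ, hQt⟩ := Ideal.exists_ideal_le_liesOver_of_le J ht
  have hφQ : ∀ f, φ f ∈ Q ↔ evalR t f = 0 := fun f => by
    rw [← RingHom.mem_ker, hQt.over]
    rfl
  obtain ⟨y, hy⟩ := exists_algHom_of_forall_sub_mem Q (fun a ha => by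
      rw [← φ.commutes, hφQ, AlgHom.commutes] at ha
      exact ha) fun b => by
    obtain ⟨q, hq, hqb⟩ := hφi b
    have h_int : IsIntegral (Ro K) (Ideal.Quotient.mk Q b) := by
      refine ⟨q.map (evalR t).toRingHom, hq.map _, ?_⟩
      have h1 : (algebraMap (Ro K) ((A0 ⧸ Q₀) ⧸ Q)).comp (evalR t).toRingHom =
          (Ideal.Quotient.mk Q).comp φ.toRingHom := by
        refine RingHom.ext fun f => (Ideal.Quotient.eq.2 ?_ : _ = Ideal.Quotient.mk Q (φ f))
        rw [← φ.commutes, ← map_sub, hφQ, map_sub, AlgHom.commutes]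
        exact sub_self _
      rw [Polynomial.eval₂_map, h1, ← Polynomial.hom_eval₂, hqb, map_zero]
    obtain ⟨a, ha⟩ := Ro.surjective_of_isIntegral h_int
    exact ⟨a, Ideal.Quotient.eq.1 ha.symm⟩
  refine ⟨y.comp (Ideal.Quotient.mkₐ (Ro K) Q₀), fun f hf => ?_⟩
  rw [← hJI]
  exact hQJ (hy.le hf)

end Points

end RigidQE
end

noncomputable section
namespace RigidQE

section Reduction

open scoped TensorProduct

variable {K : Type} [NormedField K] [CompleteSpace K] [IsAlgClosed K] [IsUltrametricDist K]
variable {A0 : Type} [CommRing A0] [Algebra (Ro K) A0]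

/-- The restriction of a point of `Sp A` to `A°`. -/
def SpPts.res (y : SpPts K A0) : A0 →ₐ[Ro K] K :=
  (y.restrictScalars (Ro K)).comp Algebra.TensorProduct.includeRight

lemma SpPts.res_apply (y : SpPts K A0) (a : A0) :
    y.res a = y (Algebra.TensorProduct.includeRight a) := rfl

lemma mem_redIdeal_iff {y : SpPts K A0} {a : A0} :
    a ∈ redIdeal K A0 y ↔ a ∈ RingHom.ker y.res ⊔ wpIdeal K A0 := Iff.rfl

theorem SpPts.norm_res_le_one (hA : IsTopFinType K A0) (y : SpPts K A0) (a : A0) :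
    ‖y.res a‖ ≤ 1 := by
  obtain ⟨m, π, hπ⟩ := hA
  obtain ⟨f, rfl⟩ := hπ a
  by_contra! h
  have h0 : y.res (π f) ≠ 0 := norm_ne_zero_iff.1 (by linarith)
  have hlt : ‖(y.res (π f))⁻¹‖ < 1 := by
    rw [norm_inv]
    exact inv_lt_one_of_one_lt₀ h
  have hu := (isUnit_one_sub_smul (ϖ := (⟨(y.res (π f))⁻¹, hlt.le⟩ : Ro K))
    (mem_RoMax_iff.2 hlt) f).map (y.res.comp π)
  refine hu.ne_zero ?_
  rw [map_sub, map_one, map_smul, AlgHom.comp_apply, Algebra.smul_def]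
  exact sub_eq_zero.2 (inv_mul_cancel₀ h0).symm

theorem mem_redIdeal_iff_norm_lt_one (hA : IsTopFinType K A0) (y : SpPts K A0) {a : A0} :
    a ∈ redIdeal K A0 y ↔ ‖y.res a‖ < 1 := by
  let ρ : A0 →ₐ[Ro K] Ro K :=
    { toFun := fun a => ⟨y.res a, y.norm_res_le_one hA a⟩
      map_one' := Subtype.ext (map_one y.res)
      map_mul' := fun a b => Subtype.ext (map_mul y.res a b)
      map_zero' := Subtype.ext (map_zero y.res)
      map_add' := fun a b => Subtype.ext (map_add y.res a b)
      commutes' := fun c => Subtype.ext (y.res.commutes c) }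
  rw [mem_redIdeal_iff]
  constructor
  · have h : RingHom.ker y.res ⊔ wpIdeal K A0 ≤ (RoMax K).comap ρ := by
      refine sup_le (fun b hb => ?_) (Ideal.map_le_iff_le_comap.2 fun c hc => ?_)
      · have : ρ b = 0 := Subtype.ext hb
        rw [Ideal.mem_comap, this]
        exact zero_mem _
      · rw [Ideal.mem_comap, Ideal.mem_comap, AlgHom.commutes]
        exact hc
    exact fun ha => h ha
  · intro ha
    rw [← sub_add_cancel a (algebraMap (Ro K) A0 (ρ a))]
    refine Submodule.add_mem_sup ?_ (Ideal.mem_map_of_mem _ ha)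
    change y.res _ = 0
    rw [map_sub, AlgHom.commutes]
    exact sub_self _

theorem redIdeal_isMaximal (hA : IsTopFinType K A0) (y : SpPts K A0) :
    (redIdeal K A0 y).IsMaximal := by
  refine Ideal.isMaximal_iff.2 ⟨?_, fun J a hJ ha haJ => ?_⟩
  · rw [mem_redIdeal_iff_norm_lt_one hA, map_one, norm_one]
    exact lt_irrefl 1
  · rw [mem_redIdeal_iff_norm_lt_one hA, not_lt] at ha
    have ha1 := (y.norm_res_le_one hA a).antisymm ha
    have h0 : y.res a ≠ 0 := norm_ne_zero_iff.1 (by simp [ha1])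
    have hb1 : ‖(y.res a)⁻¹‖ = 1 := by rw [norm_inv, ha1, inv_one]
    set b : Ro K := ⟨(y.res a)⁻¹, hb1.le⟩
    have h : 1 - algebraMap (Ro K) A0 b * a ∈ redIdeal K A0 y := by
      rw [mem_redIdeal_iff_norm_lt_one hA, map_sub, map_one, map_mul, AlgHom.commutes]
      have : algebraMap (Ro K) K b * y.res a = 1 := inv_mul_cancel₀ h0
      rw [this, sub_self, norm_zero]
      exact zero_lt_one
    rw [← sub_add_cancel 1 (algebraMap (Ro K) A0 b * a)]
    exact add_mem (hJ h) (J.mul_mem_left _ haJ)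

/-- The reduction map is surjective onto the maximal spectrum. -/
theorem exists_redIdeal_eq (hA : IsTopFinType K A0) (hflat : Module.Flat (Ro K) A0)
    (I : Ideal A0) [hI : I.IsMaximal] : ∃ y : SpPts K A0, redIdeal K A0 y = I := by
  obtain ⟨y₀, hy₀⟩ := hA.exists_algHom_ker_le hflat I
  let y : SpPts K A0 := Algebra.TensorProduct.lift (AlgHom.id K K)
    ((Algebra.ofId (Ro K) K).comp y₀) fun _ _ => Commute.all _ _
  have hy : ∀ a, y.res a = y₀ a := fun a => by
    rw [SpPts.res_apply, Algebra.TensorProduct.includeRight_apply,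
      Algebra.TensorProduct.lift_tmul, map_one, one_mul]
    rfl
  refine ⟨y, (redIdeal_isMaximal hA y).eq_of_le hI.ne_top ?_⟩
  refine fun a ha => sup_le (c := I) (fun b hb => ?_)
    (Ideal.map_le_iff_le_comap.2 fun c hc => hA.algebraMap_mem I hc) (mem_redIdeal_iff.1 ha)
  refine hy₀ (Subtype.ext ?_)
  rw [← hy b]
  exact hb

theorem preimage_redIdeal_specialLocus (hA : IsTopFinType K A0) (s r : ℕ) (h : Fin s → A0) :
    redIdeal K A0 ⁻¹' specialLocus A0 s r h = specialSet K A0 s r h := by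
  ext y
  simp only [Set.mem_preimage, specialLocus, specialSet, Set.mem_ofPred_eq,
    redIdeal_isMaximal hA y, true_and, mem_redIdeal_iff_norm_lt_one hA, not_lt, SpPts.res_apply]

theorem image_redIdeal_specialSet (hA : IsTopFinType K A0) (hflat : Module.Flat (Ro K) A0)
    (s r : ℕ) (h : Fin s → A0) :
    redIdeal K A0 '' specialSet K A0 s r h = specialLocus A0 s r h := by
  rw [← preimage_redIdeal_specialLocus hA, Set.image_preimage_eq_iff]
  intro I hI
  have := hI.1
  exact exists_redIdeal_eq hA hflat I

/-- The reduction map `ξ : Sp A → Max A°/℘A°`. -/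
def reduction (hA : IsTopFinType K A0) (y : SpPts K A0) : MaxModWp K A0 :=
  ⟨redIdeal K A0 y, redIdeal_isMaximal hA y, le_sup_right⟩

theorem reduction_surjective (hA : IsTopFinType K A0) (hflat : Module.Flat (Ro K) A0) :
    Function.Surjective (reduction hA) := fun I => by
  have := I.2.1
  obtain ⟨y, hy⟩ := exists_redIdeal_eq hA hflat I.1
  exact ⟨y, Subtype.ext hy⟩

theorem redImage_eq_image (hA : IsTopFinType K A0) (S : Set (SpPts K A0)) :
    redImage K A0 S = reduction hA '' S := by
  ext I
  exact exists_congr fun y => and_congr_right fun _ =>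
    (Subtype.ext_iff (a1 := reduction hA y)).symm

theorem BoolComb.preimage {α β : Type} (f : α → β) {G : Set (Set β)} {H : Set (Set α)}
    (h : ∀ s ∈ G, BoolComb H (f ⁻¹' s)) {s : Set β} (hs : BoolComb G s) :
    BoolComb H (f ⁻¹' s) := by
  induction hs with
  | base hs => exact h _ hs
  | compl _ ih => exact .compl ih
  | union _ _ ih₁ ih₂ => exact .union ih₁ ih₂

theorem BoolComb.exists_preimage {α β : Type} (f : α → β) {G : Set (Set β)} {H : Set (Set α)}
    (h : ∀ s ∈ H, ∃ t, BoolComb G t ∧ f ⁻¹' t = s) {s : Set α} (hs : BoolComb H s) :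
    ∃ t, BoolComb G t ∧ f ⁻¹' t = s := by
  induction hs with
  | base hs => exact h _ hs
  | compl _ ih =>
    obtain ⟨t, ht, rfl⟩ := ih
    exact ⟨_, .compl ht, rfl⟩
  | union _ _ ih₁ ih₂ =>
    obtain ⟨t, ht, rfl⟩ := ih₁
    obtain ⟨u, hu, rfl⟩ := ih₂
    exact ⟨_, .union ht hu, rfl⟩

theorem BoolComb.inter {α : Type} {G : Set (Set α)} {s t : Set α} (hs : BoolComb G s)
    (ht : BoolComb G t) : BoolComb G (s ∩ t) := by
  have h := (hs.compl.union ht.compl).compl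
  rwa [Set.compl_union, compl_compl, compl_compl] at h

theorem BoolComb.univ {α : Type} {G : Set (Set α)} {s : Set α} (hs : BoolComb G s) :
    BoolComb G Set.univ := by
  have h := hs.union hs.compl
  rwa [Set.union_compl_self] at h

theorem BoolComb.iInter {α ι : Type} [Finite ι] {G : Set (Set α)} {u : Set α}
    (hu : BoolComb G u) {s : ι → Set α} (hs : ∀ i, BoolComb G (s i)) :
    BoolComb G (⋂ i, s i) := by
  have h : ∀ t : Set ι, t.Finite → BoolComb G (⋂ i ∈ t, s i) := fun t ht => by
    induction t, ht using Set.Finite.induction_on with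
    | empty => simpa using hu.univ
    | insert _ _ ih =>
      rw [Set.biInter_insert]
      exact (hs _).inter ih
  simpa using h Set.univ Set.finite_univ

theorem mem_specialClass_iff (hA : IsTopFinType K A0) {S : Set (SpPts K A0)} :
    S ∈ specialClass K A0 ↔ ∃ C ∈ constructibleClass K A0, reduction hA ⁻¹' C = S := by
  constructor
  · refine BoolComb.exists_preimage (reduction hA) ?_
    rintro _ ⟨s, r, h, -, rfl⟩
    have hb : ∀ a : A0, BoolComb {D | ∃ a : A0, D = {I : MaxModWp K A0 | a ∈ I.1}}
        {I : MaxModWp K A0 | a ∈ I.1} := fun a => .base ⟨a, rfl⟩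
    refine ⟨⋂ i : Fin s, if (i : ℕ) < r then {I | h i ∈ I.1} else {I | h i ∈ I.1}ᶜ,
      (hb 0).iInter fun i => ?_, ?_⟩
    · split_ifs
      · exact hb _
      · exact (hb _).compl
    · rw [← preimage_redIdeal_specialLocus hA]
      ext y
      simp only [Set.mem_preimage, Set.mem_iInter, specialLocus, Set.mem_ofPred_eq,
        redIdeal_isMaximal hA y, true_and, ← forall_and]
      refine forall_congr' fun i => ?_
      split_ifs with hi
      · simp [hi, reduction]
      · simp [hi, reduction, not_lt.1 hi]
  · rintro ⟨C, hC, rfl⟩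
    refine BoolComb.preimage (reduction hA) ?_ hC
    rintro _ ⟨a, rfl⟩
    refine .base ⟨1, 1, fun _ => a, le_rfl, ?_⟩
    rw [← preimage_redIdeal_specialLocus hA]
    ext y
    simp [specialLocus, reduction, redIdeal_isMaximal hA y]

theorem bijOn_redImage (hA : IsTopFinType K A0) (hflat : Module.Flat (Ro K) A0) :
    Set.BijOn (redImage K A0) (specialClass K A0) (constructibleClass K A0) := by
  have hs := reduction_surjective hA hflat
  have key : ∀ C, redImage K A0 (reduction hA ⁻¹' C) = C := fun C => by
    rw [redImage_eq_image hA, Set.image_preimage_eq _ hs]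
  refine ⟨fun S hS => ?_, fun S hS T hT hST => ?_, fun C hC => ?_⟩
  · obtain ⟨C, hC, rfl⟩ := (mem_specialClass_iff hA).1 hS
    rwa [key]
  · obtain ⟨C, -, rfl⟩ := (mem_specialClass_iff hA).1 hS
    obtain ⟨D, -, rfl⟩ := (mem_specialClass_iff hA).1 hT
    rw [key, key] at hST
    rw [hST]
  · exact ⟨_, (mem_specialClass_iff hA).2 ⟨C, hC, rfl⟩, key C⟩

end Reduction

end RigidQE
end
noncomputable section
namespace RigidQE

/-- Let `A°` be an `R`-flat `R`-algebra topologically of finite type, `A = A° ⊗_R K`,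
and `h₁, …, h_s ∈ A°`.  Let `Σ = {y ∈ Sp A : ‖hᵢ(y)‖ < 1 for i < r, ‖hᵢ(y)‖ ≥ 1 for
r ≤ i < s}` and let `Σ°` be the locally closed subset of `Max A°` of maximal ideals
containing `hᵢ` for `i < r` and omitting `hᵢ` for `r ≤ i < s`.  Then `ξ⁻¹(Σ°) = Σ` and
`ξ(Σ) = Σ°`.  Consequently, `ξ` induces a bijection between the finite Boolean
combinations of special subsets of `Sp A` and the constructible subsets of
`Spec A°/℘A°`. -/
theorem special_sets_and_reduction
    (K : Type) [NormedField K] [CompleteSpace K] [IsAlgClosed K] [IsUltrametricDist K]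
    (A0 : Type) [CommRing A0] [Algebra (Ro K) A0]
    (hA : IsTopFinType K A0) (hflat : Module.Flat (Ro K) A0)
    (s r : ℕ) (hr : r ≤ s) (h : Fin s → A0) :
    (redIdeal K A0) ⁻¹' (specialLocus A0 s r h) = specialSet K A0 s r h ∧
    (redIdeal K A0) '' (specialSet K A0 s r h) = specialLocus A0 s r h ∧
    Set.BijOn (redImage K A0) (specialClass K A0) (constructibleClass K A0) := by
  exact ⟨preimage_redIdeal_specialLocus hA s r h, image_redIdeal_specialSet hA hflat s r h,
    bijOn_redImage hA hflat⟩

end RigidQE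
end
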